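/- arXiv:math/0404069 — 4 statements merged into one kernel-verified Lean document; each statement's English description precedes it below -/
import Mathlib

section
/- For every composite positive integer n (i.e., n > 1 and n is not prime), there exists a monic polynomial f(x) ∈ ℤ[x] of degree n that is irreducible over ℚ but whose reduction modulo p is reducible in 𝔽_p[x] for every prime p. -/
open Polynomial

lemma dvd_sub_one_of_dvd_pow_sub_one {q p r : ℕ} (hq : q.Prime) (hr : r.Coprime (q - 1))
    (hr0 : r ≠ 0) (hp : 0 < p) (h : q ∣ p ^ r - 1) : q ∣ p - 1 := by
  have := Fact.mk hq
  rw [← CharP.cast_eq_zero_iff (ZMod q), Nat.cast_sub (Nat.one_le_pow _ _ hp), sub_eq_zero] at h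
  rw [← CharP.cast_eq_zero_iff (ZMod q), Nat.cast_sub hp, sub_eq_zero]
  push_cast at h ⊢
  have hp0 : (p : ZMod q) ≠ 0 := by
    intro h0
    simp [h0, hr0] at h
  have h1 := orderOf_dvd_of_pow_eq_one h
  have h2 := orderOf_dvd_of_pow_eq_one (ZMod.pow_card_sub_one_eq_one hp0)
  exact orderOf_eq_one_iff.mp (Nat.eq_one_of_dvd_coprimes hr h1 h2)

lemma exists_pow_eq_of_norm_eq_one {K L : Type*} [Field K] [Field L] [Finite L] [Algebra K L]
    {q : ℕ} (hq : q.Prime) (hr : (Module.finrank K L).Coprime (q - 1)) {x : L}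
    (hx : Algebra.norm K x = 1) : ∃ y : L, y ^ q = x := by
  have : Finite K := Finite.of_injective _ (algebraMap K L).injective
  have hx0 : x ≠ 0 := by
    rintro rfl
    simp [Algebra.norm_zero] at hx
  have hcard : Nat.card L = Nat.card K ^ Module.finrank K L := Module.natCard_eq_pow_finrank
  have hK : 1 < Nat.card K := Finite.one_lt_card
  have hL : 1 < Nat.card L := Finite.one_lt_card
  have hdvd : Nat.card K - 1 ∣ Nat.card L - 1 := by
    rw [hcard]; simpa using Nat.sub_dvd_pow_sub_pow (Nat.card K) 1 (Module.finrank K L)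
  have hpow : x ^ ((Nat.card L - 1) / (Nat.card K - 1)) = 1 := by
    rw [← FiniteField.algebraMap_norm_eq_pow, hx, map_one]
  obtain ⟨g, hg⟩ := IsCyclic.exists_generator (α := Lˣ)
  have hgo : orderOf g = Nat.card L - 1 := by
    rw [orderOf_eq_card_of_forall_mem_zpowers hg, Nat.card_units]
  suffices ∃ y : Lˣ, y ^ q = Units.mk0 x hx0 by
    obtain ⟨y, hy⟩ := this
    exact ⟨y, by simpa using congrArg Units.val hy⟩
  by_cases hqK : q ∣ Nat.card K - 1
  · obtain ⟨k, hk⟩ := (mem_powers_iff_mem_zpowers.mpr (hg (Units.mk0 x hx0)))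
    dsimp only at hk
    obtain ⟨N, hN⟩ := hdvd
    have hKpos : 0 < Nat.card K - 1 := by omega
    rw [hN, Nat.mul_div_cancel_left _ hKpos] at hpow
    have hgN : g ^ (k * N) = 1 := by
      rw [pow_mul, hk]
      ext
      simpa using hpow
    have hNpos : 0 < N := Nat.pos_of_ne_zero (by rintro rfl; omega)
    have := orderOf_dvd_of_pow_eq_one hgN
    rw [hgo, hN] at this
    obtain ⟨m, rfl⟩ := hqK.trans (Nat.dvd_of_mul_dvd_mul_right hNpos this)
    exact ⟨g ^ m, by rw [← hk, ← pow_mul, mul_comm]⟩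
  · have hqL : (Nat.card Lˣ).Coprime q := by
      rw [Nat.card_units, Nat.coprime_comm, hq.coprime_iff_not_dvd, hcard]
      exact fun h ↦ hqK (dvd_sub_one_of_dvd_pow_sub_one hq hr Module.finrank_pos.ne' (by omega) h)
    exact (powCoprime hqL).surjective _

lemma not_irreducible_expand_of_coeff_zero {K : Type*} [Field K] [Finite K] {q : ℕ}
    (hq : q.Prime) {h : K[X]}
    (hm : h.Monic) (hr : h.natDegree.Coprime (q - 1)) (h0 : h.coeff 0 = (-1) ^ h.natDegree) :
    ¬ Irreducible (expand K q h) := by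
  intro hf
  have hh : Irreducible h := of_irreducible_expand hq.ne_zero hf
  have := Fact.mk hh
  let B := AdjoinRoot.powerBasis hh.ne_zero
  have : FiniteDimensional K (AdjoinRoot h) := B.finite
  have : Finite (AdjoinRoot h) := Module.finite_of_finite K
  have hfin : Module.finrank K (AdjoinRoot h) = h.natDegree := by
    rw [B.finrank, AdjoinRoot.powerBasis_dim]
  have hnorm : Algebra.norm K (AdjoinRoot.root h) = 1 := by
    rw [← AdjoinRoot.powerBasis_gen hh.ne_zero, Algebra.PowerBasis.norm_gen_eq_coeff_zero_minpoly,
      AdjoinRoot.minpoly_powerBasis_gen_of_monic hm, h0, AdjoinRoot.powerBasis_dim, ← mul_pow]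
    simp
  obtain ⟨y, hy⟩ := exists_pow_eq_of_norm_eq_one hq (hfin ▸ hr) hnorm
  have hroot : aeval y (expand K q h) = 0 := by
    rw [expand_aeval, hy]
    simp
  have hmin := minpoly.eq_of_irreducible_of_monic hf hroot (hm.expand hq.pos)
  have hle := minpoly.natDegree_le (A := K) y
  rw [← hmin, natDegree_expand, hfin] at hle
  have := hh.natDegree_pos
  nlinarith [hq.two_le]

lemma irreducible_expand_X_sub_one_pow_add {q r : ℕ} (hq : q.Prime)
    (hm : ((X - 1) ^ r + C (q : ℤ) * X).Monic) (hd : ((X - 1) ^ r + C (q : ℤ) * X).natDegree ≠ 0)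
    (hr : r ≠ 0) : Irreducible (expand ℤ q ((X - 1) ^ r + C (q : ℤ) * X)) := by
  have := Fact.mk hq
  set h : ℤ[X] := (X - 1) ^ r + C (q : ℤ) * X with hh
  have hfm : (expand ℤ q h).Monic := hm.expand hq.pos
  have hker : RingHom.ker (algebraMap ℤ (ZMod q)) = Ideal.span {(q : ℤ)} :=
    ZMod.ker_intCastRingHom q
  refine generalizedEisenstein (K := ZMod q) (q := X - C 1) (p := q * r) ?_ (monic_X_sub_C 1)
    hfm.isPrimitive ?_ ?_ ?_ ?_
  · rw [Polynomial.map_sub, map_X, map_C]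
    exact irreducible_X_sub_C _
  · rw [natDegree_expand]
    exact Nat.mul_pos (Nat.pos_of_ne_zero hd) hq.pos
  · rw [hfm.leadingCoeff]
    simp
  · have hmap : h.map (algebraMap ℤ (ZMod q)) = (X - 1) ^ r := by simp [hh]
    have hX : (X - 1 : (ZMod q)[X]) ^ q = X ^ q - 1 := by rw [sub_pow_expChar, one_pow]
    rw [hfm.leadingCoeff, map_expand, hmap, pow_mul]
    simp [hX]
  · rw [modByMonic_X_sub_C_eq_C_eval, map_C, Ne, C_eq_zero, hker, Ideal.Quotient.eq_zero_iff_mem,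
      Ideal.span_singleton_pow, Ideal.mem_span_singleton, expand_eval]
    simp only [hh, one_pow, eval_add, eval_mul, eval_pow, eval_sub, eval_X, eval_one, eval_C,
      sub_self, zero_pow hr, zero_add, mul_one]
    norm_cast
    intro hdvd
    have := Nat.le_of_dvd hq.pos hdvd
    nlinarith [hq.two_le]

/-- For every composite positive integer `n`, there exists a monic polynomial
`f ∈ ℤ[x]` of degree `n` that is irreducible over `ℚ` but whose reduction
modulo `p` is reducible in `𝔽_p[x]` for every prime `p`. -/
theorem stmt_0 (n : ℕ) (hn : 1 < n) (hn' : ¬ n.Prime) :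
    ∃ f : Polynomial ℤ, f.Monic ∧ f.natDegree = n ∧
      Irreducible (f.map (Int.castRingHom ℚ)) ∧
      ∀ p : ℕ, p.Prime → ¬ Irreducible (f.map (Int.castRingHom (ZMod p))) := by
  obtain ⟨r, hnr⟩ := n.minFac_dvd
  have hq : n.minFac.Prime := Nat.minFac_prime hn.ne'
  have hr : 1 < r := by
    by_contra! hr
    interval_cases r
    · omega
    · exact hn' (by rw [hnr, mul_one]; exact hq)
  have hcop : r.Coprime (n.minFac - 1) := by
    refine Nat.Coprime.symm (Nat.coprime_of_dvd fun l hl h1 h2 ↦ ?_)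
    have := Nat.minFac_le_of_dvd hl.two_le (hnr ▸ h2.mul_left _)
    have := Nat.le_of_dvd (by have := hq.two_le; omega) h1
    have := hq.two_le
    omega
  generalize n.minFac = q at *
  set h : ℤ[X] := (X - 1) ^ r + C (q : ℤ) * X with hh
  have hlt : (C (q : ℤ) * X).degree < ((X - 1 : ℤ[X]) ^ r).degree := by
    rw [← C_1, degree_pow, degree_X_sub_C]
    refine (degree_C_mul_X_le _).trans_lt ?_
    simpa using hr
  have hm : h.Monic := ((monic_X_sub_C (1 : ℤ)).pow r).add_of_left hlt
  have hd : h.natDegree = r := by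
    rw [hh, natDegree_add_eq_left_of_degree_lt hlt, ← C_1, natDegree_pow,
      natDegree_X_sub_C, mul_one]
  have h0 : h.coeff 0 = (-1) ^ r := by
    simp [hh, coeff_zero_eq_eval_zero]
  have hfm : (expand ℤ q h).Monic := hm.expand hq.pos
  refine ⟨expand ℤ q h, hfm, by rw [natDegree_expand, hd, hnr, mul_comm], ?_, fun p hp ↦ ?_⟩
  · exact (IsPrimitive.Int.irreducible_iff_irreducible_map_cast hfm.isPrimitive).mp
      (irreducible_expand_X_sub_one_pow_add hq hm (by rw [← hh, hd]; omega) (by omega))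
  · have := Fact.mk hp
    have hdp := hm.natDegree_map (Int.castRingHom (ZMod p))
    rw [map_expand]
    refine not_irreducible_expand_of_coeff_zero hq (hm.map _) ?_ ?_
    · rwa [hdp, hd]
    · rw [hdp, hd, coeff_map, h0]
      simp
end

section
/- Let ℓ be a prime and let f(x) ∈ ℤ[x] be a monic polynomial of degree ℓ that is irreducible over ℚ. Then there exist infinitely many primes p such that the reduction of f modulo p is irreducible in 𝔽_p[x]. -/
open Polynomial in
theorem Polynomial.irreducible_map_zmod_of_root {S : Type*} [CommRing S] {P : Ideal S}
    [P.IsMaximal] {p ℓ : ℕ} (hp : p.Prime) (hℓ : ℓ.Prime) (hpP : (p : S) ∈ P)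
    (hcard : Nat.card (S ⧸ P) = p ^ ℓ) {f : ℤ[X]} (hf : f.Monic) (hdeg : f.natDegree = ℓ)
    {α : S} (hα : aeval α f = 0) (hαP : ∀ c : ℤ, α - c ∉ P) :
    Irreducible (f.map (Int.castRingHom (ZMod p))) := by
  have := Fact.mk hp
  let := Ideal.Quotient.field P
  have hp0 : (p : S ⧸ P) = 0 := by
    simpa using Ideal.Quotient.eq_zero_iff_mem.mpr hpP
  have : CharP (S ⧸ P) p := (CharP.charP_iff_prime_eq_zero hp).mpr hp0
  let := ZMod.algebra (S ⧸ P) p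
  have : Finite (S ⧸ P) := Nat.finite_of_card_ne_zero (by simp [hcard, hp.ne_zero])
  have : Module.Finite (ZMod p) (S ⧸ P) := Module.Finite.of_finite
  have hrank : Module.finrank (ZMod p) (S ⧸ P) = ℓ := by
    have h := Module.natCard_eq_pow_finrank (K := ZMod p) (V := S ⧸ P)
    rw [hcard, Nat.card_zmod] at h
    exact (Nat.pow_right_injective hp.two_le h).symm
  set a : S ⧸ P := Ideal.Quotient.mk P α
  have ha : IsIntegral (ZMod p) a := .of_finite _ _
  have hroot : aeval a (f.map (Int.castRingHom (ZMod p))) = 0 := by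
    have : aeval a f = 0 := by
      simpa [hα] using aeval_algebraMap_apply (S ⧸ P) α f
    rw [aeval_def, eval₂_map]
    rwa [aeval_def, RingHom.ext_int (algebraMap ℤ (S ⧸ P))
      ((algebraMap (ZMod p) (S ⧸ P)).comp (Int.castRingHom (ZMod p)))] at this
  have hdvd := minpoly.dvd _ _ hroot
  rcases (Nat.dvd_prime hℓ).mp (hrank ▸ minpoly.degree_dvd ha) with h1 | h1
  · rw [minpoly.natDegree_eq_one_iff] at h1
    obtain ⟨c, hc⟩ := h1
    obtain ⟨c, rfl⟩ := ZMod.intCast_surjective c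
    refine absurd (Ideal.Quotient.eq_zero_iff_mem.mp ?_) (hαP c)
    rw [map_sub, sub_eq_zero, map_intCast]
    simpa using hc.symm
  · rw [eq_of_monic_of_dvd_of_natDegree_le (minpoly.monic ha) (hf.map _) hdvd
      (by rw [h1, hf.natDegree_map, hdeg])]
    exact minpoly.irreducible ha

theorem Real.exp_sub_sq_le_one_add {u : ℝ} (hu : 0 ≤ u) : Real.exp (u - u ^ 2) ≤ 1 + u := by
  rw [← Real.le_log_iff_exp_le (by linarith)]
  refine le_trans ?_ (Real.one_sub_inv_le_log_of_pos (by linarith))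
  have : 1 - (1 + u)⁻¹ - (u - u ^ 2) = u ^ 3 / (1 + u) := by field_simp; ring
  have : 0 ≤ u ^ 3 / (1 + u) := by positivity
  linarith

namespace NumberField

open Filter Topology Polynomial
open scoped Pointwise

section

variable (K : Type*) [Field K] [NumberField K]

/-- The number of ideals of `𝓞 K` of absolute norm `n`. -/
noncomputable def idealCount (n : ℕ) : ℕ := Nat.card {I : Ideal (𝓞 K) // I.absNorm = n}

instance (n : ℕ) : Finite {I : Ideal (𝓞 K) // I.absNorm = n} :=
  Ideal.finite_setOfPred_absNorm_eq n

theorem idealCount_one : idealCount K 1 = 1 := by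
  have : {I : Ideal (𝓞 K) | I.absNorm = 1} = {⊤} := by ext; simp
  rw [idealCount, ← Set.coe_ofPred, this]; simp

theorem idealCount_mul {m n : ℕ} (hmn : m.Coprime n) :
    idealCount K (m * n) = idealCount K m * idealCount K n := by
  rw [idealCount, idealCount, idealCount, ← Nat.card_prod]
  symm
  have hle (A A' B' : Ideal (𝓞 K)) (hA : A.absNorm = m) (hB : B'.absNorm = n)
      (h : A ∣ A' * B') : A ∣ A' := by
    refine IsCoprime.dvd_of_dvd_mul_right ?_ h
    rw [Ideal.isCoprime_iff_exists]
    obtain ⟨u, v, huv⟩ := Nat.isCoprime_iff_coprime.mpr hmn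
    refine ⟨u * m, A.mul_mem_left _ (hA ▸ A.absNorm_mem), v * n,
      B'.mul_mem_left _ (hB ▸ B'.absNorm_mem), ?_⟩
    exact_mod_cast congrArg (Int.cast : ℤ → 𝓞 K) huv
  refine Nat.card_congr (Equiv.ofBijective (fun x ↦ ⟨x.1.1 * x.2.1, by
    rw [map_mul, x.1.2, x.2.2]⟩) ⟨?_, ?_⟩)
  · rintro ⟨⟨A, hA⟩, B, hB⟩ ⟨⟨A', hA'⟩, B', hB'⟩ h
    replace h : A * B = A' * B' := congrArg Subtype.val h
    obtain rfl : A = A' := dvd_antisymm (hle A A' B' hA hB' (h ▸ dvd_mul_right _ _))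
      (hle A' A B hA' hB (h ▸ dvd_mul_right _ _))
    by_cases hA0 : A = ⊥
    · subst hA0
      obtain rfl : m = 0 := by simpa using hA.symm
      obtain rfl : n = 1 := by simpa using hmn
      rw [Ideal.absNorm_eq_one_iff] at hB hB'
      simp [hB, hB']
    · obtain rfl : B = B' := mul_left_cancel₀ hA0 h
      rfl
  · rintro ⟨I, hI⟩
    obtain ⟨A, B, hA, hB, rfl⟩ := exists_dvd_and_dvd_of_dvd_mul
      (a := I) (b := Ideal.span {(m : 𝓞 K)}) (c := Ideal.span {(n : 𝓞 K)}) (by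
        rw [Ideal.span_singleton_mul_span_singleton, Ideal.dvd_span_singleton]
        exact_mod_cast hI ▸ I.absNorm_mem)
    have hA' := map_dvd Ideal.absNorm hA
    have hB' := map_dvd Ideal.absNorm hB
    rw [Ideal.absNorm_span_natCast] at hA' hB'
    rw [map_mul] at hI
    have hAn : (A.absNorm).Coprime n := (hmn.pow_left _).coprime_dvd_left hA'
    have hBm : (B.absNorm).Coprime m := (hmn.symm.pow_left _).coprime_dvd_left hB'
    have h1 : A.absNorm = m := Nat.dvd_antisymm
      (hAn.dvd_of_dvd_mul_right (hI ▸ dvd_mul_right _ _))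
      (hBm.symm.dvd_of_dvd_mul_right (hI ▸ dvd_mul_right _ _))
    have h2 : B.absNorm = n := Nat.dvd_antisymm
      (hBm.dvd_of_dvd_mul_left (hI ▸ dvd_mul_left _ _))
      (hAn.symm.dvd_of_dvd_mul_left (hI ▸ dvd_mul_left _ _))
    exact ⟨⟨⟨A, h1⟩, B, h2⟩, rfl⟩

open UniqueFactorizationMonoid in
theorem idealCount_prime_pow_le {p : ℕ} (hp : p.Prime) (k : ℕ) :
    idealCount K (p ^ k) ≤ (k + 1) ^ Module.finrank ℚ K := by
  classical
  set T := (Ideal.span {(p : ℤ)}).primesOver (𝓞 K)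
  have hprime : (Ideal.span {(p : ℤ)}).IsPrime := by
    rw [Ideal.span_singleton_prime (by exact_mod_cast hp.ne_zero)]
    exact Nat.prime_iff_prime_int.mp hp
  have : Finite T := Algebra.QuasiFinite.finite_primesOver _
  have := Fintype.ofFinite T
  have hT : Nat.card T ≤ Module.finrank ℚ K := by
    rw [← RingOfIntegers.rank K,
      ← Ideal.sum_ramification_inertia_eq_finrank (Ideal.span {(p : ℤ)}) (𝓞 K),
      Nat.card_eq_fintype_card, ← Finset.card_univ, Finset.card_eq_sum_ones]
    refine Finset.sum_le_sum fun P _ ↦ ?_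
    have := P.2.1
    exact Nat.mul_pos (P.1.ramificationIdx_pos ℤ) (P.1.inertiaDeg_pos ℤ)
  have hpow : ∀ I : Ideal (𝓞 K), I.absNorm = p ^ k → I ∣ Ideal.span {(p : 𝓞 K)} ^ k := by
    intro I hI
    rw [Ideal.span_singleton_pow, Ideal.dvd_span_singleton]
    exact_mod_cast hI ▸ I.absNorm_mem
  have hle : idealCount K (p ^ k) ≤ Nat.card (T → Fin (k + 1)) := by
    have hI0 (I : {I : Ideal (𝓞 K) // I.absNorm = p ^ k}) : I.1 ≠ 0 := by
      rintro h
      have := I.2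
      simp [h, hp.ne_zero, eq_comm] at this
    have hmemT (Q I : Ideal (𝓞 K)) (hI : I.absNorm = p ^ k) (hQ : Q ∈ normalizedFactors I) :
        Q ∈ T := by
      have hQp := prime_of_normalized_factor Q hQ
      have hQ' : Q.IsPrime := Ideal.isPrime_of_prime hQp
      have hdvd := hQp.dvd_of_dvd_pow ((dvd_of_mem_normalizedFactors hQ).trans (hpow I hI))
      rw [Ideal.dvd_span_singleton] at hdvd
      exact ⟨hQ', (Ideal.liesOver_span_iff hQ'.ne_top (Nat.prime_iff_prime_int.mp hp)).mpr
        (by simpa using hdvd)⟩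
    have hbound (I : {I : Ideal (𝓞 K) // I.absNorm = p ^ k}) (P : T) :
        (normalizedFactors I.1).count P.1 < k + 1 := by
      by_cases hP : P.1 ∈ normalizedFactors I.1
      · have := P.2.1
        have := P.2.2
        have h1 : P.1 ^ (normalizedFactors I.1).count P.1 ∣ I.1 := by
          have := Multiset.prod_dvd_prod_of_le (Multiset.le_count_iff_replicate_le.mp
            (le_refl ((normalizedFactors I.1).count P.1)))
          rwa [Multiset.prod_replicate, Ideal.prod_normalizedFactors_eq_self (hI0 I)] at this
        have h2 := map_dvd Ideal.absNorm h1
        rw [map_pow, I.2, ← Ideal.pow_inertiaDeg p P.1, ← pow_mul,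
          Nat.pow_dvd_pow_iff_le_right hp.one_lt] at h2
        exact Nat.lt_succ_of_le ((Nat.le_mul_of_pos_left _ (P.1.inertiaDeg_pos ℤ)).trans h2)
      · rw [Multiset.count_eq_zero_of_notMem hP]; exact k.succ_pos
    refine Nat.card_le_card_of_injective
      (fun I P ↦ ⟨(normalizedFactors I.1).count P.1, hbound I P⟩) fun I J hIJ ↦ Subtype.ext ?_
    rw [← associated_iff_eq, associated_iff_normalizedFactors_eq_normalizedFactors (hI0 I) (hI0 J)]
    ext Q
    by_cases hQ : Q ∈ T
    · exact congrArg Fin.val (congrFun hIJ ⟨Q, hQ⟩)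
    · rw [Multiset.count_eq_zero_of_notMem fun h ↦ hQ (hmemT Q I.1 I.2 h),
        Multiset.count_eq_zero_of_notMem fun h ↦ hQ (hmemT Q J.1 J.2 h)]
  refine hle.trans ?_
  rw [Nat.card_fun, Nat.card_fin]
  exact Nat.pow_le_pow_right k.succ_pos hT

/-- The `n`-th term of the Dirichlet series of the Dedekind zeta function at the real point `s`. -/
noncomputable def zetaTerm (s : ℝ) (n : ℕ) : ℝ := idealCount K n * (n : ℝ) ^ (-s)

theorem zetaTerm_nonneg (s : ℝ) (n : ℕ) : 0 ≤ zetaTerm K s n := by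
  unfold zetaTerm; positivity

theorem term_idealCount {s : ℝ} (hs : 1 < s) (n : ℕ) :
    LSeries.term (fun n ↦ (idealCount K n : ℂ)) s n = zetaTerm K s n := by
  rcases eq_or_ne n 0 with rfl | hn
  · simp [zetaTerm, Real.zero_rpow (by linarith : -s ≠ 0)]
  · rw [LSeries.term_of_ne_zero hn, zetaTerm, Real.rpow_neg n.cast_nonneg]
    push_cast
    rw [Complex.ofReal_cpow n.cast_nonneg, div_eq_mul_inv, Complex.ofReal_natCast]

theorem summable_zetaTerm {s : ℝ} (hs : 1 < s) : Summable (zetaTerm K s) := by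
  have h : Tendsto (fun n : ℕ ↦ (∑ k ∈ Finset.Icc 1 n, (idealCount K k : ℝ)) / n) atTop
      (𝓝 (dedekindZeta_residue K)) := by
    refine ((Ideal.tendsto_norm_le_div_atTop₀ K).comp tendsto_natCast_atTop_atTop).congr fun n ↦ ?_
    simp only [Function.comp_apply, Nat.cast_le, ← Nat.cast_sum]
    congr
    rw [← add_left_inj 1, ← Ideal.card_norm_le_eq_card_norm_le_add_one,
      show Finset.Icc 1 n = Finset.Ioc 0 n from Finset.Icc_succ_left_eq_Ioc _ _,
      show 1 = idealCount K 0 by simp [idealCount, Ideal.absNorm_eq_zero_iff],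
      Finset.sum_Ioc_add_eq_sum_Icc (n.zero_le)]
    unfold idealCount
    rw [← Finset.card_preimage_eq_sum_card_image_eq
        (fun k _ ↦ Ideal.finite_setOfPred_absNorm_eq k)]
    simp [Set.coe_eq_subtype]
  have hO := h.isBigO_one ℝ
  have : LSeriesSummable (fun n ↦ (idealCount K n : ℂ)) s := by
    refine LSeriesSummable_of_sum_norm_bigO_and_nonneg (r := 1)
      (f := fun n ↦ (idealCount K n : ℝ)) ?_ (fun _ ↦ Nat.cast_nonneg _) zero_le_one
      (by simpa using hs)
    refine (hO.mul (Asymptotics.isBigO_refl (fun n : ℕ ↦ (n : ℝ)) atTop)).congr' ?_ ?_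
    · filter_upwards [eventually_ne_atTop 0] with n hn
      field_simp
    · simp
  have h2 := this.norm
  refine h2.congr fun n ↦ ?_
  rw [term_idealCount K hs, Complex.norm_real, Real.norm_of_nonneg (zetaTerm_nonneg K s n)]

theorem tendsto_sub_one_mul_tsum_zetaTerm :
    Tendsto (fun s : ℝ ↦ (s - 1) * ∑' n, zetaTerm K s n) (𝓝[>] 1)
      (𝓝 (dedekindZeta_residue K)) := by
  have h := (Complex.continuous_re.tendsto _).comp (tendsto_sub_one_mul_dedekindZeta_nhdsGT K)
  rw [Complex.ofReal_re] at h
  refine h.congr' ?_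
  filter_upwards [self_mem_nhdsWithin] with s hs
  have : dedekindZeta K s = ((∑' n, zetaTerm K s n : ℝ) : ℂ) := by
    rw [Complex.ofReal_tsum]
    exact tsum_congr (term_idealCount K hs)
  simp only [Function.comp_apply, this]
  rw [← Complex.ofReal_one, ← Complex.ofReal_sub, ← Complex.ofReal_mul, Complex.ofReal_re]

theorem tendsto_prod_tsum_zetaTerm {s : ℝ} (hs : 1 < s) :
    Tendsto (fun n : ℕ ↦ ∏ p ∈ n.primesBelow, ∑' e, zetaTerm K s (p ^ e)) atTop
      (𝓝 (∑' n, zetaTerm K s n)) := by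
  refine EulerProduct.eulerProduct ?_ ?_ (summable_zetaTerm K hs).norm ?_
  · simp [zetaTerm, idealCount_one]
  · intro m n hmn
    simp only [zetaTerm, idealCount_mul K hmn]
    push_cast
    rw [Real.mul_rpow m.cast_nonneg n.cast_nonneg]
    ring
  · simp [zetaTerm, Real.zero_rpow (by linarith : -s ≠ 0)]

theorem one_add_le_tsum_zetaTerm {s : ℝ} (hs : 1 < s) {p : ℕ} (hp : p.Prime) :
    1 + idealCount K p * (p : ℝ) ^ (-s) ≤ ∑' e, zetaTerm K s (p ^ e) := by
  have hsum : Summable fun e ↦ zetaTerm K s (p ^ e) :=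
    (summable_zetaTerm K hs).comp_injective (Nat.pow_right_injective hp.two_le)
  have := hsum.sum_le_tsum (Finset.range 2) fun e _ ↦ zetaTerm_nonneg K s _
  simpa [Finset.sum_range_succ, zetaTerm, idealCount_one] using this

theorem exists_tsum_zetaTerm_le : ∃ D : ℝ, 0 ≤ D ∧ ∀ (s : ℝ), 1 < s → ∀ p : ℕ, p.Prime →
    ∑' e, zetaTerm K s (p ^ e) ≤ 1 + idealCount K p * (p : ℝ) ^ (-s) + D / p ^ 2 := by
  set n := Module.finrank ℚ K
  have hD : Summable fun e : ℕ ↦ (e + 3 : ℝ) ^ n * (1 / 2) ^ e := by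
    have := (summable_nat_add_iff 3).mpr
      (summable_pow_mul_geometric_of_norm_lt_one n (r := (1 / 2 : ℝ)) (by norm_num))
    refine (this.mul_right 8).congr fun e ↦ ?_
    push_cast
    ring
  refine ⟨∑' e : ℕ, (e + 3 : ℝ) ^ n * (1 / 2) ^ e, tsum_nonneg fun e ↦ by positivity, ?_⟩
  intro s hs p hp
  have hsum : Summable fun e ↦ zetaTerm K s (p ^ e) :=
    (summable_zetaTerm K hs).comp_injective (Nat.pow_right_injective hp.two_le)
  rw [← hsum.sum_add_tsum_nat_add 2, ← tsum_div_const]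
  refine add_le_add (by simp [Finset.sum_range_succ, zetaTerm, idealCount_one]) ?_
  refine ((summable_nat_add_iff 2).mpr hsum).tsum_le_tsum (fun e ↦ ?_) (hD.div_const _)
  have hp2 : (2 : ℝ) ≤ p := by exact_mod_cast hp.two_le
  have hp1 : (1 : ℝ) ≤ (p ^ (e + 2) : ℕ) := by exact_mod_cast Nat.one_le_pow _ _ hp.pos
  calc zetaTerm K s (p ^ (e + 2)) ≤ (e + 3 : ℝ) ^ n * ((p ^ (e + 2) : ℕ) : ℝ) ^ (-1 : ℝ) := by
        refine mul_le_mul ?_ (Real.rpow_le_rpow_of_exponent_le hp1 (by linarith)) (by positivity)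
          (by positivity)
        have := idealCount_prime_pow_le K hp (e + 2)
        calc (idealCount K (p ^ (e + 2)) : ℝ) ≤ ((e + 2 + 1) ^ n : ℕ) := by exact_mod_cast this
          _ = (e + 3 : ℝ) ^ n := by push_cast; ring
    _ = (e + 3 : ℝ) ^ n * (1 / p) ^ e / p ^ 2 := by
        rw [Real.rpow_neg_one]
        push_cast
        rw [pow_add, mul_inv, one_div, inv_pow]
        ring
    _ ≤ (e + 3 : ℝ) ^ n * (1 / 2) ^ e / p ^ 2 := by gcongr

end

section

variable (K L : Type*) [Field K] [NumberField K] [Field L] [NumberField L]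

theorem exists_tsum_zetaTerm_pow_le (l : ℕ)
    (h : {p : ℕ | p.Prime ∧ idealCount K p < l * idealCount L p}.Finite) :
    ∃ C : ℝ, ∀ s : ℝ, 1 < s → (∑' n, zetaTerm L s n) ^ l ≤ C * ∑' n, zetaTerm K s n := by
  classical
  obtain ⟨D, hD0, hD⟩ := exists_tsum_zetaTerm_le L
  set n := Module.finrank ℚ L
  set S := {p : ℕ | p.Prime ∧ idealCount K p < l * idealCount L p}
  set M : ℝ := l * (2 ^ n + D)
  set c : ℝ := (l * 2 ^ n) ^ 2 + l * D
  set g : ℕ → ℝ := fun p ↦ c * (1 / (p : ℝ) ^ 2) + S.indicator (fun _ ↦ M) p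
  have hg0 (p : ℕ) : 0 ≤ g p :=
    add_nonneg (by positivity) (Set.indicator_nonneg (fun _ _ ↦ by positivity) _)
  have hg : Summable g := by
    refine ((Real.summable_one_div_nat_pow.mpr one_lt_two).mul_left c).add ?_
    exact summable_of_hasFiniteSupport (h.subset Set.support_indicator_subset)
  have key (s : ℝ) (hs : 1 < s) (p : ℕ) (hp : p.Prime) :
      (∑' e, zetaTerm L s (p ^ e)) ^ l ≤ Real.exp (g p) * ∑' e, zetaTerm K s (p ^ e) := by
    have hp1 : (1 : ℝ) ≤ p := by exact_mod_cast hp.one_le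
    have hx0 : (0 : ℝ) ≤ (p : ℝ) ^ (-s) := by positivity
    have hx : (p : ℝ) ^ (-s) ≤ 1 / p := by
      rw [one_div, ← Real.rpow_neg_one]
      exact Real.rpow_le_rpow_of_exponent_le hp1 (by linarith)
    have ha : (idealCount L p : ℝ) ≤ 2 ^ n := by
      have := idealCount_prime_pow_le L hp 1
      rw [pow_one] at this
      exact_mod_cast this
    set x := (p : ℝ) ^ (-s)
    set a := (idealCount L p : ℝ)
    have hK := one_add_le_tsum_zetaTerm K hs hp
    have hL : (∑' e, zetaTerm L s (p ^ e)) ^ l ≤ Real.exp (l * (a * x + D / p ^ 2)) := by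
      rw [Real.exp_nat_mul]
      refine pow_le_pow_left₀ (tsum_nonneg fun _ ↦ zetaTerm_nonneg L s _) ?_ _
      refine (hD s hs p hp).trans ?_
      linarith [Real.add_one_le_exp (a * x + D / p ^ 2)]
    have hxp : x ≤ 1 := hx.trans (by rw [div_le_one (by positivity)]; exact hp1)
    by_cases hpS : p ∈ S
    · have h1 : Real.exp (l * (a * x + D / p ^ 2)) ≤ Real.exp (g p) := by
        refine Real.exp_le_exp.mpr ?_
        have : l * (a * x + D / p ^ 2) ≤ M := by
          refine mul_le_mul_of_nonneg_left (add_le_add ?_ ?_) l.cast_nonneg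
          · exact (mul_le_mul ha hxp hx0 (by positivity)).trans_eq (mul_one _)
          · exact div_le_self hD0 (one_le_pow₀ hp1)
        have h2 : (0 : ℝ) ≤ c * (1 / (p : ℝ) ^ 2) := by positivity
        simp only [g, Set.indicator_of_mem hpS]
        linarith
      refine (hL.trans h1).trans (le_mul_of_one_le_right (Real.exp_pos _).le ?_)
      exact le_trans (by simp only [le_add_iff_nonneg_right]; positivity) hK
    · have hgood : (l : ℝ) * (idealCount L p : ℝ) ≤ idealCount K p := by
        have : l * idealCount L p ≤ idealCount K p := by
          by_contra! hlt
          exact hpS ⟨hp, hlt⟩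
        exact_mod_cast this
      set u := l * a * x
      have hu0 : 0 ≤ u := by positivity
      have hu : u ≤ l * 2 ^ n * (1 / p) := by
        simp only [u]; gcongr
      have hu2 : u ^ 2 ≤ (l * 2 ^ n) ^ 2 * (1 / p ^ 2) := by
        calc u ^ 2 ≤ (l * 2 ^ n * (1 / p)) ^ 2 := pow_le_pow_left₀ hu0 hu 2
          _ = _ := by ring
      have h1 : l * (a * x + D / p ^ 2) ≤ g p + (u - u ^ 2) := by
        simp only [g, Set.indicator_of_notMem hpS, add_zero, c]
        have : l * (a * x + D / p ^ 2) = u + l * D * (1 / p ^ 2) := by simp only [u]; ring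
        rw [this]
        linarith
      calc _ ≤ Real.exp (g p + (u - u ^ 2)) := hL.trans (Real.exp_le_exp.mpr h1)
        _ = Real.exp (g p) * Real.exp (u - u ^ 2) := Real.exp_add _ _
        _ ≤ _ := by
          refine mul_le_mul_of_nonneg_left ?_ (Real.exp_pos _).le
          refine (Real.exp_sub_sq_le_one_add hu0).trans (le_trans ?_ hK)
          gcongr
          exact mul_le_mul_of_nonneg_right hgood hx0
  refine ⟨Real.exp (∑' p, g p), fun s hs ↦ ?_⟩
  refine le_of_tendsto_of_tendsto' ((tendsto_prod_tsum_zetaTerm L hs).pow l)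
    ((tendsto_prod_tsum_zetaTerm K hs).const_mul _) fun N ↦ ?_
  rw [← Finset.prod_pow]
  refine (Finset.prod_le_prod (fun p _ ↦ pow_nonneg (tsum_nonneg fun _ ↦ zetaTerm_nonneg L s _) _)
    fun p hp ↦ key s hs p (Nat.prime_of_mem_primesBelow hp)).trans ?_
  rw [Finset.prod_mul_distrib, ← Real.exp_sum]
  refine mul_le_mul_of_nonneg_right (Real.exp_le_exp.mpr (hg.sum_le_tsum _ fun p _ ↦ hg0 p)) ?_
  exact Finset.prod_nonneg fun p _ ↦ tsum_nonneg fun _ ↦ zetaTerm_nonneg K s _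

theorem infinite_setOf_idealCount_lt {l : ℕ} (hl : 1 < l) :
    {p : ℕ | p.Prime ∧ idealCount K p < l * idealCount L p}.Infinite := by
  intro h
  obtain ⟨C, hC⟩ := exists_tsum_zetaTerm_pow_le K L l h
  have h1 := (tendsto_sub_one_mul_tsum_zetaTerm L).pow l
  have hsub : Tendsto (fun s : ℝ ↦ s - 1) (𝓝[>] 1) (𝓝 0) := by
    have : Tendsto (fun s : ℝ ↦ s - 1) (𝓝 1) (𝓝 (1 - 1)) := tendsto_id.sub_const 1
    rw [sub_self] at this
    exact this.mono_left nhdsWithin_le_nhds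
  have h2 := ((hsub.pow (l - 1)).const_mul C).mul (tendsto_sub_one_mul_tsum_zetaTerm K)
  rw [zero_pow (by lia), mul_zero, zero_mul] at h2
  refine (pow_pos (dedekindZeta_residue_pos L) l).not_ge (le_of_tendsto_of_tendsto h1 h2 ?_)
  filter_upwards [self_mem_nhdsWithin] with s hs
  have hs : 1 < s := hs
  calc ((s - 1) * ∑' n, zetaTerm L s n) ^ l = (s - 1) ^ l * (∑' n, zetaTerm L s n) ^ l := mul_pow ..
    _ ≤ (s - 1) ^ l * (C * ∑' n, zetaTerm K s n) :=
      mul_le_mul_of_nonneg_left (hC s hs) (pow_nonneg (by linarith) _)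
    _ = _ := by
      obtain ⟨m, rfl⟩ : ∃ m, l = m + 1 := ⟨l - 1, by lia⟩
      simp only [Nat.add_sub_cancel]
      ring

end

section
variable {K L : Type*} [Field K] [NumberField K] [Field L] [NumberField L] [Algebra L K]
  {G : Type*} [Group G] [Finite G] [MulSemiringAction G (𝓞 K)] [IsGaloisGroup G (𝓞 L) (𝓞 K)]

theorem ncard_primesOver_eq_of_not_irreducible {ℓ : ℕ} (hℓ : ℓ.Prime) (hG : Nat.card G = ℓ)
    {f : ℤ[X]} (hf : f.Monic) (hdeg : f.natDegree = ℓ) {α : 𝓞 K} (hα : aeval α f = 0)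
    {p : ℕ} (hp : p.Prime) (hirr : ¬ Irreducible (f.map (Int.castRingHom (ZMod p))))
    {𝔭 : Ideal (𝓞 L)} (h𝔭 : 𝔭.absNorm = p)
    (hαP : ∀ P : Ideal (𝓞 K), P.IsPrime → P.LiesOver 𝔭 → ∀ τ : G, τ ≠ 1 → τ • α - α ∉ P) :
    (𝔭.primesOver (𝓞 K)).ncard = ℓ ∧ ∀ P ∈ 𝔭.primesOver (𝓞 K), P.absNorm = p := by
  have : 𝔭.IsPrime := Ideal.isPrime_of_irreducible_absNorm (h𝔭 ▸ hp)
  have h𝔭0 : 𝔭 ≠ ⊥ := by rintro rfl; simp [hp.ne_zero.symm] at h𝔭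
  have key : ∀ P ∈ 𝔭.primesOver (𝓞 K), P.absNorm = p ∧ (𝔭.primesOver (𝓞 K)).ncard = ℓ := by
    rintro P ⟨_, _⟩
    have hP0 : P ≠ ⊥ := Ideal.ne_bot_of_liesOver_of_ne_bot h𝔭0 P
    have : P.IsMaximal := Ideal.IsPrime.isMaximal inferInstance hP0
    have hI : P.inertia G = ⊥ := by
      rw [eq_bot_iff]
      intro τ hτ
      by_contra h
      exact hαP P inferInstance inferInstance τ h (AddSubgroup.mem_inertia.mp hτ α)
    have hmul := Ideal.ncard_primesOver_mul_card_inertia_mul_finrank (G := G) 𝔭 P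
    rw [hI, Subgroup.card_bot, mul_one, hG] at hmul
    have hnorm := Ideal.absNorm_pow_inertiaDeg 𝔭 P
    rcases (Nat.dvd_prime hℓ).mp (Dvd.intro_left _ hmul) with h1 | h1
    · rw [h1, h𝔭, pow_one] at hnorm
      rw [h1, mul_one] at hmul
      exact ⟨hnorm.symm, hmul⟩
    · refine absurd ?_ hirr
      rw [h1] at hmul hnorm
      have hn : (𝔭.primesOver (𝓞 K)).ncard = 1 := by
        simpa [hℓ.ne_zero] using hmul
      obtain ⟨Q, hQ⟩ := Set.ncard_eq_one.mp hn
      have hstab (τ : G) : τ • P = P := by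
        have h1 : τ • P ∈ 𝔭.primesOver (𝓞 K) := ⟨inferInstance, inferInstance⟩
        have h2 : P ∈ 𝔭.primesOver (𝓞 K) := ⟨inferInstance, inferInstance⟩
        rw [hQ] at h1 h2
        exact h1.trans h2.symm
      refine irreducible_map_zmod_of_root (P := P) (α := α) hp hℓ ?_ ?_ hf hdeg hα fun c hc ↦ ?_
      · have := Ideal.absNorm_mem P
        rw [← hnorm, h𝔭, Nat.cast_pow] at this
        exact Ideal.IsPrime.mem_of_pow_mem inferInstance _ this
      · rw [← h𝔭, hnorm, Ideal.absNorm_apply, Submodule.cardQuot_apply]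
      · have : Nontrivial G := by
          rw [← Finite.one_lt_card_iff_nontrivial, hG]; exact hℓ.one_lt
        obtain ⟨τ, hτ⟩ := exists_ne (1 : G)
        have h3 : τ • (α - c) ∈ P := by
          rw [← hstab τ]; exact Ideal.smul_mem_pointwise_smul _ _ _ hc
        refine hαP P inferInstance inferInstance τ hτ ?_
        have := P.sub_mem h3 hc
        have hc' : τ • (c : 𝓞 K) = c := map_intCast (MulSemiringAction.toRingHom G (𝓞 K) τ) c
        rwa [smul_sub, hc', sub_sub_sub_cancel_right] at this
  obtain ⟨P, hP⟩ : (𝔭.primesOver (𝓞 K)).Nonempty := Set.nonempty_coe_sort.mp inferInstance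
  exact ⟨(key P hP).2, fun P hP ↦ (key P hP).1⟩

theorem mul_idealCount_le {ℓ p : ℕ}
    (h : ∀ 𝔭 : Ideal (𝓞 L), 𝔭.absNorm = p → (𝔭.primesOver (𝓞 K)).ncard = ℓ ∧
      ∀ P ∈ 𝔭.primesOver (𝓞 K), P.absNorm = p) :
    ℓ * idealCount L p ≤
      idealCount K p := by
  have : Finite {I : Ideal (𝓞 L) // I.absNorm = p} := Ideal.finite_setOfPred_absNorm_eq p
  have : Finite {I : Ideal (𝓞 K) // I.absNorm = p} := Ideal.finite_setOfPred_absNorm_eq p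
  have := Fintype.ofFinite {I : Ideal (𝓞 L) // I.absNorm = p}
  have hcard : Nat.card (Σ 𝔭 : {I : Ideal (𝓞 L) // I.absNorm = p}, 𝔭.1.primesOver (𝓞 K)) =
      ℓ * idealCount L p := by
    have (𝔭 : {I : Ideal (𝓞 L) // I.absNorm = p}) : Finite (𝔭.1.primesOver (𝓞 K)) :=
      ((Ideal.finite_setOfPred_absNorm_eq p).subset (h 𝔭.1 𝔭.2).2).to_subtype
    rw [Nat.card_sigma, Finset.sum_congr rfl fun 𝔭 _ ↦ (h 𝔭.1 𝔭.2).1]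
    simp [idealCount, mul_comm]
  rw [← hcard]
  refine Nat.card_le_card_of_injective
    (fun x ↦ (⟨x.2.1, (h x.1.1 x.1.2).2 _ x.2.2⟩ : {I : Ideal (𝓞 K) // I.absNorm = p})) ?_
  rintro ⟨⟨𝔭, h𝔭⟩, P, h1, h2⟩ ⟨⟨𝔮, h𝔮⟩, Q, h3, h4⟩ hPQ
  obtain rfl : P = Q := congrArg Subtype.val hPQ
  obtain rfl : 𝔭 = 𝔮 := h2.over.trans h4.over.symm
  rfl

theorem finite_setOf_not_irreducible_idealCount_lt {ℓ : ℕ} (hℓ : ℓ.Prime) (hG : Nat.card G = ℓ)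
    {f : ℤ[X]} (hf : f.Monic) (hdeg : f.natDegree = ℓ) {α : 𝓞 K} (hα : aeval α f = 0)
    {σ : G} (hσ : σ • α ≠ α) :
    {p : ℕ | p.Prime ∧ ¬ Irreducible (f.map (Int.castRingHom (ZMod p))) ∧
      idealCount K p <
        ℓ * idealCount L p}.Finite := by
  have := Fintype.ofFinite G
  classical
  have hfix (τ : G) (hτ : τ ≠ 1) : τ • α ≠ α := by
    intro h
    have hs : MulAction.stabilizer G α = ⊤ := by
      have : Fact (Nat.card G).Prime := ⟨hG ▸ hℓ⟩
      refine (Subgroup.eq_bot_or_eq_top_of_prime_card _).resolve_left fun hb ↦ hτ ?_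
      have : τ ∈ MulAction.stabilizer G α := h
      rwa [hb, Subgroup.mem_bot] at this
    exact hσ (show σ ∈ MulAction.stabilizer G α by simp [hs])
  set δ : 𝓞 K := ∏ τ ∈ Finset.univ.erase (1 : G), (τ • α - α) with hδ
  have hδ0 : δ ≠ 0 := Finset.prod_ne_zero_iff.mpr fun τ hτ ↦
    sub_ne_zero.mpr (hfix τ (Finset.ne_of_mem_erase hτ))
  have hN : (Ideal.span {δ}).absNorm ≠ 0 := by simpa [Ideal.absNorm_eq_zero_iff] using hδ0
  refine (Ideal.span {δ}).absNorm.divisors.finite_toSet.subset ?_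
  rintro p ⟨hp, hirr, hlt⟩
  simp only [Finset.mem_coe, Nat.mem_divisors]
  refine ⟨?_, hN⟩
  by_contra hpN
  refine hlt.not_ge (mul_idealCount_le fun 𝔭 h𝔭 ↦
    ncard_primesOver_eq_of_not_irreducible (G := G) hℓ hG hf hdeg hα hp hirr h𝔭
      fun P _ _ τ hτ hmem ↦ hpN ?_)
  have hδP : δ ∈ P := P.mem_of_dvd (Finset.dvd_prod_of_mem _ (by simpa using hτ)) hmem
  refine dvd_trans ?_ (map_dvd Ideal.absNorm (Ideal.dvd_span_singleton.mpr hδP))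
  rw [← Ideal.absNorm_pow_inertiaDeg 𝔭 P, h𝔭]
  exact dvd_pow_self _ (P.inertiaDeg_pos (𝓞 L)).ne'
end

section

variable (K : Type*) [Field K] [NumberField K]

theorem infinite_setOf_irreducible_map_zmod {ℓ : ℕ} (hℓ : ℓ.Prime) {f : ℤ[X]} (hf : f.Monic)
    (hdeg : f.natDegree = ℓ) (hirr : Irreducible (f.map (Int.castRingHom ℚ)))
    [IsSplittingField ℚ K (f.map (Int.castRingHom ℚ))] :
    {p : ℕ | p.Prime ∧ Irreducible (f.map (Int.castRingHom (ZMod p)))}.Infinite := by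
  set F := f.map (Int.castRingHom ℚ)
  have hFdeg : F.natDegree = ℓ := by rw [hf.natDegree_map, hdeg]
  have : IsGalois ℚ K := IsGalois.of_separable_splitting_field (p := F) hirr.separable
  have : Fact ℓ.Prime := ⟨hℓ⟩
  obtain ⟨σ, hσ⟩ : ∃ σ : Gal(K/ℚ), orderOf σ = ℓ := by
    refine exists_prime_orderOf_dvd_card' ℓ ?_
    have := Gal.prime_degree_dvd_card hirr (hFdeg ▸ hℓ)
    rw [hFdeg] at this
    rwa [Nat.card_congr (IsSplittingField.algEquiv K F).autCongr.toEquiv]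
  obtain ⟨α, hα, hne⟩ : ∃ α : K, aeval α f = 0 ∧ σ α ≠ α := by
    by_contra! hfix
    have h1 : σ = 1 := by
      refine AlgEquiv.ext fun x ↦ ?_
      have : (σ : K →ₐ[ℚ] K) = AlgHom.id ℚ K := by
        refine AlgHom.ext_of_adjoin_eq_top
          (IsSplittingField.adjoin_rootSet K F) fun β hβ ↦ hfix β ?_
        rw [← aeval_map_algebraMap ℚ]
        exact aeval_eq_zero_of_mem_rootSet hβ
      exact DFunLike.congr_fun this x
    rw [h1, orderOf_one] at hσ
    exact hℓ.one_lt.ne hσ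
  let C := Subgroup.zpowers σ
  let L := (FixedPoints.intermediateField C : IntermediateField ℚ K)
  have : IsGaloisGroup C (𝓞 L) (𝓞 K) := IsGaloisGroup.of_isFractionRing C (𝓞 L) (𝓞 K) L K
  have hC : Nat.card C = ℓ := by rw [Nat.card_zpowers, hσ]
  obtain ⟨a, rfl⟩ : ∃ a : 𝓞 K, algebraMap (𝓞 K) K a = α := ⟨⟨α, f, hf, hα⟩, rfl⟩
  have ha : aeval a f = 0 := by
    refine RingOfIntegers.coe_injective ?_
    rw [map_zero, ← hα, aeval_algebraMap_apply]
  have hfin := finite_setOf_not_irreducible_idealCount_lt (K := K) (L := L) (G := C)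
    hℓ hC hf hdeg ha (σ := ⟨σ, Subgroup.mem_zpowers σ⟩)
    (fun h ↦ hne (congrArg (algebraMap _ K) h))
  intro hirrfin
  refine infinite_setOf_idealCount_lt K L hℓ.one_lt
    ((hirrfin.union hfin).subset ?_)
  rintro p ⟨hp, hlt⟩
  by_cases h : Irreducible (f.map (Int.castRingHom (ZMod p)))
  · exact .inl ⟨hp, h⟩
  · exact .inr ⟨hp, h, hlt⟩

end

end NumberField

/-- If `ℓ` is prime and `f ∈ ℤ[x]` is monic of degree `ℓ` and irreducible over `ℚ`,
then there are infinitely many primes `p` such that the reduction of `f` mod `p`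
is irreducible in `𝔽_p[x]`. -/
theorem stmt_1 (ℓ : ℕ) (hℓ : ℓ.Prime) (f : Polynomial ℤ) (hf : f.Monic)
    (hdeg : f.natDegree = ℓ)
    (hirr : Irreducible (f.map (Int.castRingHom ℚ))) :
    {p : ℕ | p.Prime ∧ Irreducible (f.map (Int.castRingHom (ZMod p)))}.Infinite := by
  have : NumberField (f.map (Int.castRingHom ℚ)).SplittingField := {}
  have : Polynomial.IsSplittingField ℚ (f.map (Int.castRingHom ℚ)).SplittingField
      (f.map (Int.castRingHom ℚ)) := by
    convert Polynomial.IsSplittingField.splittingField (f.map (Int.castRingHom ℚ))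
    exact Subsingleton.elim _ _
  exact NumberField.infinite_setOf_irreducible_map_zmod
    (f.map (Int.castRingHom ℚ)).SplittingField hℓ hf hdeg hirr
end

section
/- Let f(x) ∈ ℤ[x] be a monic polynomial of degree 4, irreducible over ℚ, with splitting field K over ℚ. Then the reduction of f modulo p is reducible in 𝔽_p[x] for every prime p if and only if Gal(K/ℚ) is isomorphic either to the Klein four group ℤ/2 × ℤ/2 or to the alternating group A₄ on four letters. -/
open Ideal NumberField Filter Topology UniqueFactorizationMonoid

theorem sum_rpow_absNorm_le_prod {S : Type*} [CommRing S] [IsDedekindDomain S] [Module.Free ℤ S]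
    (s : ℝ) (F : Finset (Ideal S)) (hF : ∀ I ∈ F, I ≠ ⊥) :
    ∃ T : Finset (Ideal S), ∃ n : ℕ, (∀ P ∈ T, P.IsPrime ∧ P ≠ ⊥) ∧
      ∑ I ∈ F, (absNorm I : ℝ) ^ s ≤
        ∏ P ∈ T, ∑ k ∈ Finset.range n, ((absNorm P : ℝ) ^ s) ^ k := by
  classical
  refine ⟨F.biUnion fun I ↦ (normalizedFactors I).toFinset,
    F.sup (fun I ↦ (normalizedFactors I).card) + 1, fun P hP ↦ ?_, ?_⟩
  · obtain ⟨I, -, hI⟩ := Finset.mem_biUnion.mp hP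
    have := prime_of_normalized_factor P (Multiset.mem_toFinset.mp hI)
    exact ⟨isPrime_of_prime this, this.ne_zero⟩
  set T := F.biUnion fun I ↦ (normalizedFactors I).toFinset with hT
  have hprod (I) (hI : I ∈ F) : ∏ P ∈ T, P ^ (normalizedFactors I).count P = I := by
    rw [← Finset.prod_multiset_count_of_subset _ _ (Finset.subset_biUnion_of_mem
      (fun I ↦ (normalizedFactors I).toFinset) hI)]
    exact Ideal.prod_normalizedFactors_eq_self (hF I hI)
  have hw (I) (hI : I ∈ F) : (absNorm I : ℝ) ^ s =
      ∏ P ∈ T, ((absNorm P : ℝ) ^ s) ^ (normalizedFactors I).count P := by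
    conv_lhs => rw [← hprod I hI]
    simp only [map_prod, map_pow, Nat.cast_prod, Nat.cast_pow]
    rw [← Real.finsetProd_rpow _ _ fun _ _ ↦ by positivity]
    refine Finset.prod_congr rfl fun P _ ↦ ?_
    rw [← Real.rpow_natCast, ← Real.rpow_natCast, ← Real.rpow_mul (by positivity),
      ← Real.rpow_mul (by positivity), mul_comm]
  rw [Finset.prod_sum, Finset.sum_congr rfl hw]
  have hinj : Set.InjOn (fun I P (_ : P ∈ T) ↦ (normalizedFactors I).count P) F := by
    intro I hI J hJ h
    rw [← hprod I hI, ← hprod J hJ]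
    exact Finset.prod_congr rfl fun P hP ↦
      congrArg (P ^ ·) (congrFun (congrFun h P) hP)
  calc _ = ∑ I ∈ F, ∏ P ∈ T.attach, ((absNorm P.1 : ℝ) ^ s) ^ (normalizedFactors I).count P.1 :=
        Finset.sum_congr rfl fun I _ ↦ (Finset.prod_attach T
          fun P ↦ ((absNorm P : ℝ) ^ s) ^ (normalizedFactors I).count P).symm
    _ = ∑ p ∈ F.image (fun I P (_ : P ∈ T) ↦ (normalizedFactors I).count P),
        ∏ x ∈ T.attach, ((absNorm x.1 : ℝ) ^ s) ^ p x.1 x.2 := by rw [Finset.sum_image hinj]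
    _ ≤ _ := by
      refine Finset.sum_le_sum_of_subset_of_nonneg (fun p hp ↦ ?_) fun _ _ _ ↦ by positivity
      obtain ⟨I, hI, rfl⟩ := Finset.mem_image.mp hp
      refine Finset.mem_pi.mpr fun P _ ↦ Finset.mem_range.mpr (Nat.lt_succ_of_le ?_)
      exact (Multiset.count_le_card _ _).trans
        (Finset.le_sup (f := fun I ↦ (normalizedFactors I).card) hI)

theorem prod_one_add_rpow_absNorm_le_tsum {S : Type*} [CommRing S] [IsDedekindDomain S]
    [Module.Free ℤ S] {s : ℝ} (hs : Summable fun I : Ideal S ↦ (absNorm I : ℝ) ^ s)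
    (T : Finset (Ideal S)) (hT : ∀ P ∈ T, P.IsPrime ∧ P ≠ ⊥) :
    ∏ P ∈ T, (1 + (absNorm P : ℝ) ^ s) ≤ ∑' I : Ideal S, (absNorm I : ℝ) ^ s := by
  classical
  have hfac (U) (hU : U ∈ T.powerset) : normalizedFactors (∏ P ∈ U, P) = U.val := by
    have : ∏ P ∈ U, P = U.val.prod := U.prod_val.symm
    rw [this]
    exact normalizedFactors_prod_of_prime fun P hP ↦
      prime_of_isPrime (hT P (Finset.mem_powerset.mp hU hP)).2
        (hT P (Finset.mem_powerset.mp hU hP)).1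
  have hinj : Set.InjOn (fun U : Finset (Ideal S) ↦ ∏ P ∈ U, P) T.powerset := by
    intro U hU V hV h
    exact Finset.val_injective ((hfac U hU).symm.trans (Eq.trans (congrArg _ h) (hfac V hV)))
  rw [Finset.prod_one_add]
  calc _ = ∑ I ∈ T.powerset.image (fun U ↦ ∏ P ∈ U, P), (absNorm I : ℝ) ^ s := by
        rw [Finset.sum_image hinj]
        refine Finset.sum_congr rfl fun U _ ↦ ?_
        simp only [map_prod, Nat.cast_prod]
        exact Real.finsetProd_rpow _ _ (fun _ _ ↦ by positivity) _
    _ ≤ _ := hs.sum_le_tsum _ fun _ _ ↦ by positivity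

theorem hasSum_rpow_absNorm (L : Type*) [Field L] [NumberField L] {s : ℝ} (hs : 1 < s) :
    ∃ z : ℝ, HasSum (fun I : Ideal (𝓞 L) ↦ (absNorm I : ℝ) ^ (-s)) z ∧ dedekindZeta L s = z := by
  set a : ℕ → ℝ := fun n ↦ Nat.card {I : Ideal (𝓞 L) // absNorm I = n} with ha
  have hfin (n : ℕ) : Finite {I : Ideal (𝓞 L) // absNorm I = n} := finite_setOfPred_absNorm_eq n
  have hlim : Tendsto (fun n : ℕ ↦ (∑ k ∈ Finset.Icc 1 n, a k) / n) atTop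
      (𝓝 (dedekindZeta_residue L)) := by
    refine ((Ideal.tendsto_norm_le_div_atTop₀ L).comp tendsto_natCast_atTop_atTop).congr fun n ↦ ?_
    simp only [Function.comp_apply, Nat.cast_le, ← Nat.cast_sum, ha]
    congr
    rw [← add_left_inj 1, ← card_norm_le_eq_card_norm_le_add_one,
      show Finset.Icc 1 n = Finset.Ioc 0 n from Finset.Icc_succ_left_eq_Ioc _ _,
      show 1 = Nat.card {I : Ideal (𝓞 L) // absNorm I = 0} by simp [Ideal.absNorm_eq_zero_iff],
      Finset.sum_Ioc_add_eq_sum_Icc (n.zero_le),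
      ← Finset.card_preimage_eq_sum_card_image_eq (fun k _ ↦ finite_setOfPred_absNorm_eq k)]
    simp [Set.coe_eq_subtype]
  have hO : (fun n : ℕ ↦ ∑ k ∈ Finset.Icc 1 n, a k) =O[atTop] fun n ↦ (n : ℝ) ^ (1 : ℝ) := by
    simp only [Real.rpow_one]
    refine Asymptotics.isBigO_of_div_tendsto_nhds ?_ _ hlim
    filter_upwards [eventually_ne_atTop 0] with n hn h
    exact absurd h (by exact_mod_cast hn)
  have hterm (n : ℕ) : LSeries.term (fun n ↦ (a n : ℂ)) s n = (a n * (n : ℝ) ^ (-s) : ℝ) := by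
    rcases eq_or_ne n 0 with rfl | hn
    · simp [Real.zero_rpow (by linarith : -s ≠ 0)]
    · rw [LSeries.term_of_ne_zero hn, Real.rpow_neg (by positivity), div_eq_mul_inv]
      push_cast
      rw [Complex.ofReal_cpow (by positivity)]
      simp
  have hsum : Summable fun n : ℕ ↦ a n * (n : ℝ) ^ (-s) := by
    have := LSeriesSummable_of_sum_norm_bigO_and_nonneg (s := (s : ℂ)) hO
      (fun _ ↦ Nat.cast_nonneg _) zero_le_one (by simpa using hs)
    rw [LSeriesSummable, funext hterm] at this
    exact_mod_cast this
  let e := Equiv.sigmaFiberEquiv (absNorm : Ideal (𝓞 L) → ℕ)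
  have hfib (n : ℕ) : HasSum (fun I : {I : Ideal (𝓞 L) // absNorm I = n} ↦
      (absNorm (e ⟨n, I⟩) : ℝ) ^ (-s)) (a n * (n : ℝ) ^ (-s)) := by
    have : Fintype {I : Ideal (𝓞 L) // absNorm I = n} := Fintype.ofFinite _
    have h (I : {I : Ideal (𝓞 L) // absNorm I = n}) :
        (absNorm (e ⟨n, I⟩) : ℝ) ^ (-s) = (n : ℝ) ^ (-s) := by
      simp [e, I.2]
    simpa [h, ha, Nat.card_eq_fintype_card] using
      hasSum_fintype fun I : {I : Ideal (𝓞 L) // absNorm I = n} ↦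
        (absNorm (e ⟨n, I⟩) : ℝ) ^ (-s)
  have hsig : Summable fun x ↦ (absNorm (e x) : ℝ) ^ (-s) := by
    rw [summable_sigma_of_nonneg fun _ ↦ by positivity]
    refine ⟨fun n ↦ (hfib n).summable, ?_⟩
    simpa only [fun n ↦ (hfib n).tsum_eq] using hsum
  refine ⟨∑' n, a n * (n : ℝ) ^ (-s), ?_, ?_⟩
  · rw [← e.hasSum_iff]
    convert! hsig.hasSum using 1
    rw [hsig.tsum_sigma]
    simp only [fun n ↦ (hfib n).tsum_eq]
  · rw [dedekindZeta, LSeries, Complex.ofReal_tsum]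
    refine tsum_congr fun n ↦ ?_
    rw [← hterm]
    simp [ha]

theorem summable_rpow_absNorm (L : Type*) [Field L] [NumberField L] {s : ℝ} (hs : 1 < s) :
    Summable fun I : Ideal (𝓞 L) ↦ (absNorm I : ℝ) ^ (-s) :=
  let ⟨_, h, _⟩ := hasSum_rpow_absNorm L hs
  h.summable

theorem tendsto_sub_one_mul_tsum_rpow_absNorm (L : Type*) [Field L] [NumberField L] :
    Tendsto (fun s : ℝ ↦ (s - 1) * ∑' I : Ideal (𝓞 L), (absNorm I : ℝ) ^ (-s)) (𝓝[>] 1)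
      (𝓝 (dedekindZeta_residue L)) := by
  have := Complex.continuous_re.continuousAt.tendsto.comp
    (tendsto_sub_one_mul_dedekindZeta_nhdsGT L)
  rw [Complex.ofReal_re] at this
  refine this.congr' ?_
  filter_upwards [self_mem_nhdsWithin] with s hs
  obtain ⟨z, hz, h⟩ := hasSum_rpow_absNorm L hs
  rw [Function.comp_apply, h, hz.tsum_eq, ← Complex.ofReal_one, ← Complex.ofReal_sub,
    ← Complex.ofReal_mul, Complex.ofReal_re]

theorem card_le_finrank_of_natCast_mem {S : Type*} [CommRing S] [IsDedekindDomain S]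
    [Module.Free ℤ S] [Module.Finite ℤ S] {p : ℕ} (hp : p.Prime) (U : Finset (Ideal S))
    (hU : ∀ P ∈ U, (P.IsPrime ∧ P ≠ ⊥) ∧ (p : S) ∈ P) : U.card ≤ Module.finrank ℤ S := by
  classical
  have hdvd : ∏ P ∈ U, P ∣ span {(p : S)} :=
    Finset.prod_primes_dvd _ (fun P hP ↦ prime_of_isPrime (hU P hP).1.2 (hU P hP).1.1)
      fun P hP ↦ dvd_span_singleton.mpr (hU P hP).2
  have h1 : absNorm (∏ P ∈ U, P) ∣ p ^ Module.finrank ℤ S := by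
    rw [← absNorm_span_natCast]
    exact map_dvd _ hdvd
  have h2 : p ^ U.card ∣ absNorm (∏ P ∈ U, P) := by
    rw [map_prod, ← Finset.prod_const]
    refine Finset.prod_dvd_prod_of_dvd _ _ fun P hP ↦ ?_
    have h3 : absNorm P ∣ p ^ Module.finrank ℤ S := by
      rw [← absNorm_span_natCast]
      exact map_dvd _ (dvd_span_singleton.mpr (hU P hP).2)
    obtain ⟨k, -, hk⟩ := (Nat.dvd_prime_pow hp).mp h3
    rw [hk]
    refine dvd_pow_self p fun h ↦ (hU P hP).1.1.ne_top ?_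
    rw [← absNorm_eq_one_iff, hk, h, pow_zero]
  exact (Nat.pow_dvd_pow_iff_le_right hp.one_lt).mp (h2.trans h1)

theorem exists_sum_rpow_absNorm_not_prime_le (S : Type*) [CommRing S] [IsDedekindDomain S]
    [Module.Free ℤ S] [Module.Finite ℤ S] [Algebra.IsIntegral ℤ S] :
    ∃ C : ℝ, ∀ s : ℝ, 1 ≤ s → ∀ T : Finset (Ideal S),
      (∀ P ∈ T, (P.IsPrime ∧ P ≠ ⊥) ∧ ¬ (absNorm P).Prime) →
        ∑ P ∈ T, (absNorm P : ℝ) ^ (-s) ≤ C := by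
  classical
  have hsum : Summable fun n : ℕ ↦ ((n : ℝ) ^ 2)⁻¹ := Real.summable_nat_pow_inv.mpr one_lt_two
  refine ⟨Module.finrank ℤ S * ∑' n : ℕ, ((n : ℝ) ^ 2)⁻¹, fun s hs T hT ↦ ?_⟩
  have key (P) (hP : P ∈ T) : ∃ p : ℕ, p.Prime ∧ (p : S) ∈ P ∧ (absNorm P).minFac = p ∧
      (absNorm P : ℝ) ^ (-s) ≤ ((p : ℝ) ^ 2)⁻¹ := by
    have := (hT P hP).1.1
    have := this.isMaximal (hT P hP).1.2
    obtain ⟨p, n, hn, hpP, hp, h⟩ := exists_prime_and_absNorm_eq_pow P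
    have hn2 : 2 ≤ n := by
      by_contra hlt
      obtain rfl : n = 1 := by omega
      exact (hT P hP).2 (by rwa [h, pow_one])
    have hp1 : (1 : ℝ) ≤ p := by exact_mod_cast hp.one_le
    refine ⟨p, hp, hpP, by rw [h, hp.pow_minFac hn.ne'], ?_⟩
    rw [h, Real.rpow_neg (by positivity)]
    refine inv_anti₀ (pow_pos (by linarith) 2) ?_
    calc (p : ℝ) ^ 2 ≤ (p : ℝ) ^ n := pow_le_pow_right₀ hp1 hn2
      _ = (((p ^ n : ℕ) : ℝ)) ^ (1 : ℝ) := by simp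
      _ ≤ _ := Real.rpow_le_rpow_of_exponent_le (by exact_mod_cast Nat.one_le_pow _ _ hp.pos) hs
  calc _ ≤ ∑ P ∈ T, (((absNorm P).minFac : ℝ) ^ 2)⁻¹ := by
        refine Finset.sum_le_sum fun P hP ↦ ?_
        obtain ⟨p, -, -, h, h'⟩ := key P hP
        rwa [h]
    _ = ∑ p ∈ T.image (fun P ↦ (absNorm P).minFac), ∑ P ∈ T with (absNorm P).minFac = p,
          (((absNorm P).minFac : ℝ) ^ 2)⁻¹ :=
        (Finset.sum_fiberwise_of_maps_to (fun P hP ↦ Finset.mem_image_of_mem _ hP) _).symm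
    _ ≤ ∑ p ∈ T.image (fun P ↦ (absNorm P).minFac), Module.finrank ℤ S * ((p : ℝ) ^ 2)⁻¹ := by
        refine Finset.sum_le_sum fun p hp ↦ ?_
        rw [Finset.sum_congr rfl (g := fun _ ↦ ((p : ℝ) ^ 2)⁻¹)
          fun P hP ↦ by rw [(Finset.mem_filter.mp hP).2], Finset.sum_const, nsmul_eq_mul]
        gcongr
        obtain ⟨Q, hQ, rfl⟩ := Finset.mem_image.mp hp
        obtain ⟨q, hq, -, h, -⟩ := key Q hQ
        rw [h]
        refine card_le_finrank_of_natCast_mem hq _ fun P hP ↦ ?_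
        rw [Finset.mem_filter] at hP
        obtain ⟨r, hr, hrP, h, -⟩ := key P hP.1
        exact ⟨(hT P hP.1).1, by rwa [← hP.2, h]⟩
    _ ≤ _ := by
        rw [← Finset.mul_sum]
        gcongr
        exact hsum.sum_le_tsum _ fun _ _ ↦ by positivity

theorem two_le_absNorm {S : Type*} [CommRing S] [IsDedekindDomain S]
    [Module.Free ℤ S] [Module.Finite ℤ S] [CharZero S] {P : Ideal S} (hP : P.IsPrime ∧ P ≠ ⊥) :
    2 ≤ absNorm P := by
  have h0 : absNorm P ≠ 0 := fun h ↦ hP.2 (absNorm_eq_zero_iff.mp h)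
  have h1 : absNorm P ≠ 1 := fun h ↦ hP.1.ne_top (absNorm_eq_one_iff.mp h)
  omega

theorem rpow_neg_sq_le {x s : ℝ} (hx : 1 ≤ x) (hs : 1 ≤ s) :
    (x ^ (-s)) ^ 2 ≤ x ^ (-2 : ℝ) := by
  rw [← Real.rpow_natCast, ← Real.rpow_mul (by linarith)]
  exact Real.rpow_le_rpow_of_exponent_le hx (by push_cast; linarith)

theorem exists_exp_sum_le_tsum_rpow_absNorm (L : Type*) [Field L] [NumberField L] :
    ∃ C : ℝ, ∀ s : ℝ, 1 < s → ∀ T : Finset (Ideal (𝓞 L)), (∀ P ∈ T, P.IsPrime ∧ P ≠ ⊥) →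
      Real.exp (∑ P ∈ T, (absNorm P : ℝ) ^ (-s)) ≤
        Real.exp C * ∑' I : Ideal (𝓞 L), (absNorm I : ℝ) ^ (-s) := by
  have h2 := summable_rpow_absNorm L one_lt_two
  refine ⟨∑' I : Ideal (𝓞 L), (absNorm I : ℝ) ^ (-2 : ℝ), fun s hs T hT ↦ ?_⟩
  have hsq : ∑ P ∈ T, ((absNorm P : ℝ) ^ (-s)) ^ 2 ≤
      ∑' I : Ideal (𝓞 L), (absNorm I : ℝ) ^ (-2 : ℝ) := by
    refine le_trans (Finset.sum_le_sum fun P hP ↦ ?_) (h2.sum_le_tsum T fun _ _ ↦ by positivity)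
    exact rpow_neg_sq_le (by exact_mod_cast one_le_two.trans (two_le_absNorm (hT P hP))) hs.le
  have hexp (x : ℝ) (hx : 0 ≤ x) : Real.exp x ≤ Real.exp (x ^ 2) * (1 + x) := by
    have h1 : 1 ≤ Real.exp (x ^ 2 - x) * (1 + x) := by
      have := Real.add_one_le_exp (x ^ 2 - x)
      nlinarith [pow_nonneg hx 3]
    calc Real.exp x ≤ Real.exp x * (Real.exp (x ^ 2 - x) * (1 + x)) :=
          le_mul_of_one_le_right (Real.exp_nonneg _) h1
      _ = _ := by rw [← mul_assoc, ← Real.exp_add, add_sub_cancel]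
  calc _ = ∏ P ∈ T, Real.exp ((absNorm P : ℝ) ^ (-s)) := Real.exp_sum _ _
    _ ≤ ∏ P ∈ T, (Real.exp (((absNorm P : ℝ) ^ (-s)) ^ 2) * (1 + (absNorm P : ℝ) ^ (-s))) :=
        Finset.prod_le_prod (fun _ _ ↦ by positivity) fun P _ ↦ hexp _ (by positivity)
    _ = Real.exp (∑ P ∈ T, ((absNorm P : ℝ) ^ (-s)) ^ 2) *
        ∏ P ∈ T, (1 + (absNorm P : ℝ) ^ (-s)) := by
        rw [Finset.prod_mul_distrib, Real.exp_sum]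
    _ ≤ _ := by
        gcongr
        exact prod_one_add_rpow_absNorm_le_tsum (summable_rpow_absNorm L hs) T hT

theorem exists_tsum_rpow_absNorm_le_exp (L : Type*) [Field L] [NumberField L]
    (A : Finset (Ideal (𝓞 L))) :
    ∃ C : ℝ, ∀ s : ℝ, 1 < s → ∀ B : ℝ,
      (∀ T : Finset (Ideal (𝓞 L)),
        (∀ P ∈ T, (P.IsPrime ∧ P ≠ ⊥) ∧ (absNorm P).Prime ∧ P ∉ A) →
          ∑ P ∈ T, (absNorm P : ℝ) ^ (-s) ≤ B) →
      ∑' I : Ideal (𝓞 L), (absNorm I : ℝ) ^ (-s) ≤ Real.exp (B + C) := by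
  classical
  have h2 := summable_rpow_absNorm L one_lt_two
  obtain ⟨C₁, hC₁⟩ := exists_sum_rpow_absNorm_not_prime_le (𝓞 L)
  refine ⟨C₁ + A.card + 2 * ∑' I : Ideal (𝓞 L), (absNorm I : ℝ) ^ (-2 : ℝ), fun s hs B hB ↦ ?_⟩
  refine Real.tsum_le_of_sum_le (fun _ ↦ by positivity) fun F ↦ ?_
  obtain ⟨T, n, hT, hle⟩ := sum_rpow_absNorm_le_prod (-s) (F.erase ⊥)
    fun I hI ↦ Finset.ne_of_mem_erase hI
  have hF : ∑ I ∈ F, (absNorm I : ℝ) ^ (-s) = ∑ I ∈ F.erase ⊥, (absNorm I : ℝ) ^ (-s) :=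
    (Finset.sum_erase _ (by simp [Real.zero_rpow (by linarith : -s ≠ 0)])).symm
  have hN (P) (hP : P ∈ T) : (2 : ℝ) ≤ absNorm P := by exact_mod_cast two_le_absNorm (hT P hP)
  have hhalf (P) (hP : P ∈ T) : (absNorm P : ℝ) ^ (-s) ≤ 1 / 2 := by
    calc (absNorm P : ℝ) ^ (-s) ≤ (absNorm P : ℝ) ^ (-1 : ℝ) :=
          Real.rpow_le_rpow_of_exponent_le (by linarith [hN P hP]) (by linarith)
      _ = 1 / absNorm P := by rw [Real.rpow_neg_one, one_div]
      _ ≤ _ := one_div_le_one_div_of_le two_pos (hN P hP)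
  have hgeom (x : ℝ) (hx : 0 ≤ x) (hx2 : x ≤ 1 / 2) :
      ∑ k ∈ Finset.range n, x ^ k ≤ Real.exp (x + 2 * x ^ 2) := by
    calc _ ≤ (1 - x)⁻¹ := by
          rw [← tsum_geometric_of_lt_one hx (by linarith)]
          exact (summable_geometric_of_lt_one hx (by linarith)).sum_le_tsum _
            fun _ _ ↦ by positivity
      _ ≤ x + 2 * x ^ 2 + 1 := by
          rw [inv_le_iff_one_le_mul₀ (by linarith)]
          nlinarith [mul_nonneg (sq_nonneg x) (by linarith : 0 ≤ 1 - 2 * x)]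
      _ ≤ _ := Real.add_one_le_exp _
  have hsq : ∑ P ∈ T, ((absNorm P : ℝ) ^ (-s)) ^ 2 ≤
      ∑' I : Ideal (𝓞 L), (absNorm I : ℝ) ^ (-2 : ℝ) := by
    refine le_trans (Finset.sum_le_sum fun P hP ↦ ?_) (h2.sum_le_tsum T fun _ _ ↦ by positivity)
    exact rpow_neg_sq_le (by linarith [hN P hP]) hs.le
  have hsplit : ∑ P ∈ T, (absNorm P : ℝ) ^ (-s) ≤ B + C₁ + A.card := by
    rw [← Finset.sum_filter_add_sum_filter_not T (fun P ↦ P ∈ A),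
      ← Finset.sum_filter_add_sum_filter_not (T.filter fun P ↦ P ∉ A) fun P ↦ (absNorm P).Prime]
    have hA : ∑ P ∈ T with P ∈ A, (absNorm P : ℝ) ^ (-s) ≤ A.card := by
      calc _ ≤ ∑ P ∈ T with P ∈ A, (1 : ℝ) := Finset.sum_le_sum fun P hP ↦
            (hhalf P (Finset.mem_of_mem_filter P hP)).trans (by norm_num)
        _ = (T.filter fun P ↦ P ∈ A).card := by simp
        _ ≤ _ := by
          exact_mod_cast Finset.card_le_card fun P hP ↦ (Finset.mem_filter.mp hP).2
    have h1 := hB ((T.filter fun P ↦ P ∉ A).filter fun P ↦ (absNorm P).Prime) fun P hP ↦ by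
      simp only [Finset.mem_filter] at hP
      exact ⟨hT P hP.1.1, hP.2, hP.1.2⟩
    have h2 := hC₁ s hs.le ((T.filter fun P ↦ P ∉ A).filter fun P ↦ ¬ (absNorm P).Prime)
      fun P hP ↦ by
        simp only [Finset.mem_filter] at hP
        exact ⟨hT P hP.1.1, hP.2⟩
    linarith
  calc _ ≤ ∏ P ∈ T, ∑ k ∈ Finset.range n, ((absNorm P : ℝ) ^ (-s)) ^ k := hF.trans_le hle
    _ ≤ ∏ P ∈ T, Real.exp ((absNorm P : ℝ) ^ (-s) + 2 * ((absNorm P : ℝ) ^ (-s)) ^ 2) :=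
        Finset.prod_le_prod (fun _ _ ↦ by positivity)
          fun P hP ↦ hgeom _ (by positivity) (hhalf P hP)
    _ = Real.exp (∑ P ∈ T, (absNorm P : ℝ) ^ (-s) + 2 * ∑ P ∈ T, ((absNorm P : ℝ) ^ (-s)) ^ 2) := by
        rw [← Real.exp_sum, Finset.sum_add_distrib, Finset.mul_sum]
    _ ≤ _ := Real.exp_le_exp.mpr (by linarith)

/-- Infinitely many degree one primes of `E` do not have two distinct primes of relative degree one
above them in `L`. -/
theorem exists_absNorm_prime_not_split (E L : Type*) [Field E] [NumberField E] [Field L]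
    [NumberField L] [Algebra E L] (A : Finset (Ideal (𝓞 E))) :
    ∃ P : Ideal (𝓞 E), (P.IsPrime ∧ P ≠ ⊥) ∧ (absNorm P).Prime ∧ P ∉ A ∧
      ¬ ∃ Q₁ Q₂ : Ideal (𝓞 L), Q₁ ≠ Q₂ ∧
        (Q₁.IsPrime ∧ absNorm Q₁ = absNorm P ∧ Q₁.under (𝓞 E) = P) ∧
        (Q₂.IsPrime ∧ absNorm Q₂ = absNorm P ∧ Q₂.under (𝓞 E) = P) := by
  classical
  by_contra! hcon
  choose! q₁ q₂ hne h₁ h₂ using hcon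
  obtain ⟨C₁, hC₁⟩ := exists_exp_sum_le_tsum_rpow_absNorm L
  obtain ⟨C₂, hC₂⟩ := exists_tsum_rpow_absNorm_le_exp E A
  set ZE : ℝ → ℝ := fun s ↦ ∑' I : Ideal (𝓞 E), (absNorm I : ℝ) ^ (-s) with hZE
  set ZL : ℝ → ℝ := fun s ↦ ∑' I : Ideal (𝓞 L), (absNorm I : ℝ) ^ (-s) with hZL
  have hle (s : ℝ) (hs : 1 < s) : ZE s ^ 2 ≤ Real.exp (2 * C₂) * (Real.exp C₁ * ZL s) := by
    have hpos : 0 < Real.exp C₁ * ZL s :=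
      (Real.exp_pos _).trans_le (hC₁ s hs ∅ (by simp))
    have hB := hC₂ s hs (Real.log (Real.exp C₁ * ZL s) / 2) fun T hT ↦ by
      have hinj₁ : Set.InjOn q₁ T := fun P hP P' hP' h ↦ by
        rw [← (h₁ P (hT P hP).1 (hT P hP).2.1 (hT P hP).2.2).2.2, h,
          (h₁ P' (hT P' hP').1 (hT P' hP').2.1 (hT P' hP').2.2).2.2]
      have hinj₂ : Set.InjOn q₂ T := fun P hP P' hP' h ↦ by
        rw [← (h₂ P (hT P hP).1 (hT P hP).2.1 (hT P hP).2.2).2.2, h,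
          (h₂ P' (hT P' hP').1 (hT P' hP').2.1 (hT P' hP').2.2).2.2]
      have hdisj : Disjoint (T.image q₁) (T.image q₂) := by
        rw [Finset.disjoint_left]
        rintro Q hQ hQ'
        obtain ⟨P, hP, rfl⟩ := Finset.mem_image.mp hQ
        obtain ⟨P', hP', h⟩ := Finset.mem_image.mp hQ'
        obtain rfl : P' = P := by
          rw [← (h₂ P' (hT P' hP').1 (hT P' hP').2.1 (hT P' hP').2.2).2.2, h,
            (h₁ P (hT P hP).1 (hT P hP).2.1 (hT P hP).2.2).2.2]
        exact hne P' (hT P' hP').1 (hT P' hP').2.1 (hT P' hP').2.2 h.symm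
      have hQ : ∀ Q ∈ T.image q₁ ∪ T.image q₂, Q.IsPrime ∧ Q ≠ ⊥ := by
        intro Q hQ
        simp only [Finset.mem_union, Finset.mem_image] at hQ
        have hbot (P) (hP : P ∈ T) (h : absNorm Q = absNorm P) : Q ≠ ⊥ := by
          rintro rfl
          exact (hT P hP).2.1.ne_zero (by rw [← h, absNorm_bot])
        obtain ⟨P, hP, rfl⟩ | ⟨P, hP, rfl⟩ := hQ
        · obtain ⟨h, h', -⟩ := h₁ P (hT P hP).1 (hT P hP).2.1 (hT P hP).2.2
          exact ⟨h, hbot P hP h'⟩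
        · obtain ⟨h, h', -⟩ := h₂ P (hT P hP).1 (hT P hP).2.1 (hT P hP).2.2
          exact ⟨h, hbot P hP h'⟩
      have := (Real.le_log_iff_exp_le hpos).mpr (hC₁ s hs _ hQ)
      have e₁ : ∑ P ∈ T, (absNorm (q₁ P) : ℝ) ^ (-s) = ∑ P ∈ T, (absNorm P : ℝ) ^ (-s) :=
        Finset.sum_congr rfl fun P hP ↦ by rw [(h₁ P (hT P hP).1 (hT P hP).2.1 (hT P hP).2.2).2.1]
      have e₂ : ∑ P ∈ T, (absNorm (q₂ P) : ℝ) ^ (-s) = ∑ P ∈ T, (absNorm P : ℝ) ^ (-s) :=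
        Finset.sum_congr rfl fun P hP ↦ by rw [(h₂ P (hT P hP).1 (hT P hP).2.1 (hT P hP).2.2).2.1]
      rw [Finset.sum_union hdisj, Finset.sum_image hinj₁, Finset.sum_image hinj₂, e₁, e₂] at this
      change _ ≤ Real.log (Real.exp C₁ * ZL s) at this
      linarith
    calc ZE s ^ 2 ≤ Real.exp (Real.log (Real.exp C₁ * ZL s) / 2 + C₂) ^ 2 :=
          pow_le_pow_left₀ (tsum_nonneg fun _ ↦ by positivity) hB 2
      _ = Real.exp (2 * C₂ + Real.log (Real.exp C₁ * ZL s)) := by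
          rw [← Real.exp_nat_mul]
          congr 1
          push_cast
          ring
      _ = _ := by rw [Real.exp_add, Real.exp_log hpos]
  have hE : Tendsto (fun s ↦ ((s - 1) * ZE s) ^ 2) (𝓝[>] 1) (𝓝 (dedekindZeta_residue E ^ 2)) :=
    (tendsto_sub_one_mul_tsum_rpow_absNorm E).pow 2
  have hs0 : Tendsto (fun s : ℝ ↦ s - 1) (𝓝[>] 1) (𝓝 0) := by
    have : Tendsto (fun s : ℝ ↦ s - 1) (𝓝 1) (𝓝 (1 - 1)) :=
      (continuous_id.sub continuous_const).tendsto 1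
    rw [sub_self] at this
    exact this.mono_left nhdsWithin_le_nhds
  have hL : Tendsto (fun s ↦ Real.exp (2 * C₂) * Real.exp C₁ * ((s - 1) * ((s - 1) * ZL s)))
      (𝓝[>] 1) (𝓝 0) := by
    simpa using (hs0.mul (tendsto_sub_one_mul_tsum_rpow_absNorm L)).const_mul
      (Real.exp (2 * C₂) * Real.exp C₁)
  have := le_of_tendsto_of_tendsto hE hL <| by
    filter_upwards [self_mem_nhdsWithin] with s hs
    calc ((s - 1) * ZE s) ^ 2 = (s - 1) ^ 2 * ZE s ^ 2 := mul_pow _ _ _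
      _ ≤ (s - 1) ^ 2 * (Real.exp (2 * C₂) * (Real.exp C₁ * ZL s)) := by
          gcongr
          exact hle s hs
      _ = _ := by ring
  exact this.not_gt (pow_pos (dedekindZeta_residue_pos E) 2)

theorem charP_quotient_of_natCast_mem {S : Type*} [CommRing S] {p : ℕ} (hp : p.Prime)
    {Q : Ideal S} [Q.IsPrime] (hpQ : (p : S) ∈ Q) : CharP (S ⧸ Q) p := by
  refine (CharP.charP_iff_prime_eq_zero hp).2 ?_
  rw [← map_natCast (Ideal.Quotient.mk Q), Ideal.Quotient.eq_zero_iff_mem]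
  exact hpQ

theorem ne_bot_of_natCast_mem {S : Type*} [CommRing S] [CharZero S] {p : ℕ} (hp : p.Prime)
    {Q : Ideal S} (hpQ : (p : S) ∈ Q) : Q ≠ ⊥ := by
  rintro rfl
  exact hp.ne_zero (by exact_mod_cast (Submodule.mem_bot S).1 hpQ)

/-- If `x ↦ x ^ p` is the identity on a number ring modulo a prime `Q` containing `p`, then `Q` has
degree one. -/
theorem absNorm_eq_of_forall_pow_sub_mem {S : Type*} [CommRing S] [IsDedekindDomain S]
    [Module.Free ℤ S] [CharZero S] {p : ℕ} (hp : p.Prime) {Q : Ideal S} [Q.IsPrime]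
    (hpQ : (p : S) ∈ Q) (h : ∀ x, x ^ p - x ∈ Q) :
    absNorm Q = p ∧ ∀ x, ∃ a : ℤ, x - (a : S) ∈ Q := by
  have := Fact.mk hp
  have : Q.IsMaximal := IsPrime.isMaximal ‹_› (ne_bot_of_natCast_mem hp hpQ)
  let _ := Ideal.Quotient.field Q
  have := charP_quotient_of_natCast_mem hp hpQ
  have hs : Function.Surjective (ZMod.castHom dvd_rfl (S ⧸ Q) : ZMod p →+* S ⧸ Q) := fun x ↦ by
    have hx : x ∈ (⊥ : Subfield (S ⧸ Q)) := by
      rw [Subfield.mem_bot_iff_pow_eq_self (S ⧸ Q) p]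
      obtain ⟨x, rfl⟩ := Ideal.Quotient.mk_surjective x
      rw [← map_pow, Ideal.Quotient.eq]
      exact h x
    exact (bot_le : ⊥ ≤ (ZMod.castHom dvd_rfl (S ⧸ Q) : ZMod p →+* S ⧸ Q).fieldRange) hx
  constructor
  · rw [absNorm_apply, Submodule.cardQuot_apply, ← Nat.card_zmod p]
    exact (Nat.card_congr (Equiv.ofBijective _ ⟨RingHom.injective _, hs⟩)).symm
  · intro x
    obtain ⟨a, ha⟩ := hs (Ideal.Quotient.mk Q x)
    obtain ⟨a, rfl⟩ := ZMod.intCast_surjective a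
    refine ⟨a, ?_⟩
    rw [← Ideal.Quotient.eq, ← ha]
    simp

/-- If `E'` is fixed by `g ^ 2` but not by `g`, then infinitely many primes of `K` have degree one
over `E` and a Frobenius element outside `⟨g ^ 2⟩`. -/
theorem exists_isArithFrob_of_cyclic
    {E E' K : Type*} [Field E] [NumberField E] [Field E'] [NumberField E'] [Field K]
    [NumberField K] [Algebra E E'] [Algebra E K] [Algebra E' K] [IsScalarTower E E' K]
    [IsGalois E K] (g : Gal(K/E))
    (hE' : ∀ y : E', g (g (algebraMap E' K y)) = algebraMap E' K y) (y : 𝓞 E')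
    (hy : g • algebraMap (𝓞 E') (𝓞 K) y ≠ algebraMap (𝓞 E') (𝓞 K) y) {δ : 𝓞 K} (hδ : δ ≠ 0) :
    ∃ p : ℕ, p.Prime ∧ ∃ 𝔓 : Ideal (𝓞 K), 𝔓.IsPrime ∧ (p : 𝓞 K) ∈ 𝔓 ∧ δ ∉ 𝔓 ∧
      ∃ σ : Gal(K/E), σ ∉ Subgroup.zpowers (g ^ 2) ∧ ∀ x : 𝓞 K, σ • x - x ^ p ∈ 𝔓 := by
  set z := algebraMap (𝓞 E') (𝓞 K) y with hz
  have hgg (w : 𝓞 E') : g • g • algebraMap (𝓞 E') (𝓞 K) w = algebraMap (𝓞 E') (𝓞 K) w :=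
    RingOfIntegers.ext (hE' w)
  set N := Algebra.norm ℤ (δ * (g • z - z)) with hN
  have hN0 : N ≠ 0 := Algebra.norm_ne_zero_iff.2 (mul_ne_zero hδ (sub_ne_zero.2 hy))
  obtain ⟨P, ⟨hP, hP0⟩, hp, hPA, hsplit⟩ := exists_absNorm_prime_not_split E E'
    (Ideal.finite_setOfPred_absNorm_le (S := 𝓞 E) N.natAbs).toFinset
  have hPmax : P.IsMaximal := hP.isMaximal hP0
  obtain ⟨𝔓, h𝔓, hover⟩ := Ideal.exists_maximal_ideal_liesOver_of_isIntegral (S := 𝓞 K) P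
  obtain ⟨p, hpP⟩ : ∃ p, p = absNorm P := ⟨_, rfl⟩
  rw [← hpP] at hp
  have hpN : N.natAbs < p := by simpa [hpP] using hPA
  have hpmem : (p : 𝓞 K) ∈ 𝔓 := by
    have : (p : 𝓞 E) ∈ P := hpP ▸ absNorm_mem P
    rw [hover.over, mem_under] at this
    simpa using this
  have hmem : δ * (g • z - z) ∉ 𝔓 := fun hmem ↦ by
    have h1 : (N.natAbs : 𝓞 K) ∈ 𝔓 := by
      rw [hN, ← absNorm_span_singleton]
      exact (span_singleton_le_iff_mem 𝔓).2 hmem (absNorm_mem _)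
    have h2 : Nat.Coprime p N.natAbs :=
      Nat.coprime_of_lt_prime (Int.natAbs_pos.2 hN0).ne' hpN hp
    have h3 := (Nat.isCoprime_iff_coprime.2 h2).map (Int.castRingHom (𝓞 K))
    obtain ⟨a, b, h⟩ := h3
    refine h𝔓.ne_top ((Ideal.eq_top_iff_one 𝔓).2 (h ▸ ?_))
    exact 𝔓.add_mem (𝔓.mul_mem_left _ (by simpa using hpmem)) (𝔓.mul_mem_left _ (by simpa using h1))
  have hδ𝔓 : δ ∉ 𝔓 := fun h ↦ hmem (𝔓.mul_mem_right _ h)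
  have hz𝔓 : g • z - z ∉ 𝔓 := fun h ↦ hmem (𝔓.mul_mem_left _ h)
  have : 𝔓 ≠ ⊥ := Ring.ne_bot_of_isMaximal_of_not_isField h𝔓 (RingOfIntegers.not_isField K)
  have : Finite (𝓞 K ⧸ 𝔓) := finiteQuotientOfFreeOfNeBot 𝔓 this
  obtain ⟨σ, hσ⟩ := IsArithFrobAt.exists_of_isInvariant (𝓞 E) Gal(K/E) 𝔓
  have hσ' (x : 𝓞 K) : σ • x - x ^ p ∈ 𝔓 := by
    have := hσ x
    rwa [← hover.over, ← Submodule.cardQuot_apply, ← absNorm_apply, ← hpP] at this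
  refine ⟨p, hp, 𝔓, inferInstance, hpmem, hδ𝔓, σ, fun hσg ↦ hsplit ?_, hσ'⟩
  have hfix (w : 𝓞 E') : σ • algebraMap (𝓞 E') (𝓞 K) w = algebraMap (𝓞 E') (𝓞 K) w := by
    have : Subgroup.zpowers (g ^ 2) ≤ MulAction.stabilizer _ (algebraMap (𝓞 E') (𝓞 K) w) := by
      rw [Subgroup.zpowers_le, MulAction.mem_stabilizer_iff, pow_two, mul_smul, hgg]
    exact this hσg
  have h1 (x : 𝓞 E') : x ^ p - x ∈ 𝔓.under (𝓞 E') := by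
    rw [mem_under, ← neg_mem_iff]
    simpa [hfix] using hσ' (algebraMap (𝓞 E') (𝓞 K) x)
  let τ : 𝓞 K →ₐ[𝓞 E] 𝓞 K := MulSemiringAction.toAlgHom (𝓞 E) (𝓞 K) g
  let 𝔔 := 𝔓.comap τ
  have hfix' (w : 𝓞 E') :
      σ • g • algebraMap (𝓞 E') (𝓞 K) w = g • algebraMap (𝓞 E') (𝓞 K) w := by
    have : Subgroup.zpowers (g ^ 2) ≤
        MulAction.stabilizer _ (g • algebraMap (𝓞 E') (𝓞 K) w) := by
      rw [Subgroup.zpowers_le, MulAction.mem_stabilizer_iff, pow_two, mul_smul, hgg]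
    exact this hσg
  have hτ (x : 𝓞 K) : x ∈ 𝔔 ↔ g • x ∈ 𝔓 := Iff.rfl
  have h𝔔 : 𝔔.IsPrime := Ideal.comap_isPrime τ 𝔓
  have h2 (x : 𝓞 E') : x ^ p - x ∈ 𝔔.under (𝓞 E') := by
    rw [mem_under, hτ, ← neg_mem_iff]
    simpa [hfix', smul_sub] using hσ' (g • algebraMap (𝓞 E') (𝓞 K) x)
  have h3 := absNorm_eq_of_forall_pow_sub_mem hp (by rw [mem_under]; simpa using hpmem) h1
  have h4 := absNorm_eq_of_forall_pow_sub_mem hp (Q := 𝔔.under (𝓞 E'))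
    (by
      rwa [mem_under, map_natCast, hτ,
        show g • (p : 𝓞 K) = p from map_natCast (MulSemiringAction.toRingHom _ (𝓞 K) g) p]) h2
  refine ⟨𝔓.under (𝓞 E'), 𝔔.under (𝓞 E'), fun h ↦ hz𝔓 ?_, ⟨inferInstance, ?_, ?_⟩,
    inferInstance, ?_, ?_⟩
  · obtain ⟨a, ha⟩ := h3.2 y
    have ha' := h ▸ ha
    rw [mem_under] at ha
    rw [mem_under, hτ] at ha'
    have := 𝔓.sub_mem ha' ha
    simp only [map_sub, smul_sub, map_intCast, ← hz] at this
    convert this using 1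
    have : g • (a : 𝓞 K) = a := map_intCast (MulSemiringAction.toRingHom _ (𝓞 K) g) a
    rw [this]; ring
  · rw [h3.1, hpP]
  · rw [under_under, hover.over]
  · rw [h4.1, hpP]
  · rw [under_under, hover.over]
    ext x
    simp only [mem_under, hτ]
    rw [smul_algebraMap]

/-- A weak form of Frobenius' density theorem for a cyclic group `⟨g⟩` of even order: there are
infinitely many primes with a Frobenius element in `⟨g⟩` outside `⟨g ^ 2⟩`. -/
theorem exists_isArithFrob_mem_zpowers {K : Type*} [Field K] [NumberField K] [IsGalois ℚ K]
    {g : Gal(K/ℚ)} (hg : g ∉ Subgroup.zpowers (g ^ 2)) {δ : 𝓞 K} (hδ : δ ≠ 0) :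
    ∃ p : ℕ, p.Prime ∧ ∃ 𝔓 : Ideal (𝓞 K), 𝔓.IsPrime ∧ (p : 𝓞 K) ∈ 𝔓 ∧ δ ∉ 𝔓 ∧
      ∃ σ ∈ Subgroup.zpowers g, σ ∉ Subgroup.zpowers (g ^ 2) ∧ ∀ x : 𝓞 K, σ • x - x ^ p ∈ 𝔓 := by
  let E := IntermediateField.fixedField (Subgroup.zpowers g)
  let e : Subgroup.zpowers g ≃* Gal(K/E) := IntermediateField.subgroupEquivAlgEquiv _
  have he (τ : Subgroup.zpowers g) (x : K) : e τ x = τ.1 x := rfl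
  let g' : Gal(K/E) := e ⟨g, Subgroup.mem_zpowers g⟩
  let E' := IntermediateField.fixedField (Subgroup.zpowers (g' ^ 2))
  have : NumberField E' := NumberField.of_module_finite E E'
  have key : g' ∉ Subgroup.zpowers (g' ^ 2) := by
    rintro ⟨n, hn⟩
    refine hg ⟨n, ?_⟩
    have := congrArg (fun τ ↦ (e.symm τ).1) hn
    simpa [g'] using this
  obtain ⟨y, hyE, hy⟩ : ∃ y ∈ E', g' y ≠ y := by
    by_contra! h
    refine key ?_
    rw [← IntermediateField.fixingSubgroup_fixedField (Subgroup.zpowers (g' ^ 2))]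
    exact (IntermediateField.mem_fixingSubgroup_iff _ _).2 h
  have hgg (y : E') : g' (g' (algebraMap E' K y)) = algebraMap E' K y := by
    have := IntermediateField.fixingSubgroup_fixedField (Subgroup.zpowers (g' ^ 2)) ▸
      Subgroup.mem_zpowers (g' ^ 2)
    exact (IntermediateField.mem_fixingSubgroup_iff _ _).1 this y y.2
  obtain ⟨m, hm0, hm⟩ := ((IsFractionRing.isAlgebraic_iff ℤ ℚ E').2
    (Algebra.IsAlgebraic.isAlgebraic (⟨y, hyE⟩ : E'))).exists_integral_multiple
  have hw : g' • algebraMap (𝓞 E') (𝓞 K) ⟨_, hm⟩ ≠ algebraMap (𝓞 E') (𝓞 K) ⟨_, hm⟩ := fun h ↦ by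
    have h1 : g' (m • y) = m • y := congrArg (algebraMap (𝓞 K) K) h
    rw [map_zsmul] at h1
    exact hy (smul_right_injective K hm0 h1)
  obtain ⟨p, hp, 𝔓, h𝔓, hp𝔓, hδ𝔓, σ, hσ, hσx⟩ :=
    exists_isArithFrob_of_cyclic (E := E) (E' := E') (K := K) g' hgg _ hw hδ
  refine ⟨p, hp, 𝔓, h𝔓, hp𝔓, hδ𝔓, (e.symm σ).1, (e.symm σ).2, fun ⟨n, hn⟩ ↦ hσ ⟨n, ?_⟩, ?_⟩
  · apply e.symm.injective
    ext1
    simpa [g'] using hn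
  · intro x
    convert hσx x
    ext
    have := he (e.symm σ) x
    rw [e.apply_symm_apply] at this
    exact this.symm

open Polynomial

theorem natDegree_minpoly_dvd_iff {p : ℕ} [Fact p.Prime] {k : Type*} [Field k]
    [Algebra (ZMod p) k] {a : k} (ha : IsIntegral (ZMod p) a) {n : ℕ} :
    (minpoly (ZMod p) a).natDegree ∣ n ↔ a ^ p ^ n = a := by
  rw [(minpoly.irreducible ha).natDegree_dvd_iff_dvd_X_pow_card_pow_sub_X, minpoly.dvd_iff,
    Nat.card_zmod]
  simp [sub_eq_zero]

theorem irreducible_map_zmod_iff_natDegree_minpoly {p : ℕ} [Fact p.Prime] {k : Type*} [Field k]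
    [Algebra (ZMod p) k] {f : ℤ[X]} (hf : f.Monic) {a : k} (ha : aeval a f = 0) :
    IsIntegral (ZMod p) a ∧ (Irreducible (f.map (Int.castRingHom (ZMod p))) ↔
      (minpoly (ZMod p) a).natDegree = f.natDegree) := by
  have hm := hf.map (Int.castRingHom (ZMod p))
  have ha' : aeval a (f.map (Int.castRingHom (ZMod p))) = 0 := by
    rwa [← algebraMap_int_eq, aeval_map_algebraMap]
  have hαint : IsIntegral (ZMod p) a := ⟨_, hm, ha'⟩
  refine ⟨hαint, fun h ↦ ?_, fun h ↦ ?_⟩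
  · rw [← minpoly.eq_of_irreducible_of_monic h ha' hm, hf.natDegree_map]
  · rw [eq_of_monic_of_dvd_of_natDegree_le (minpoly.monic hαint) hm (minpoly.dvd _ _ ha')
      (by rw [hf.natDegree_map, h])]
    exact minpoly.irreducible hαint

theorem mk_pow_smul_eq_of_forall_smul_sub_pow_mem {K : Type*} [Field K] {p : ℕ}
    {𝔓 : Ideal (𝓞 K)} {G : Type*} [Group G] [MulSemiringAction G (𝓞 K)] {σ : G}
    (hσ : ∀ x : 𝓞 K, σ • x - x ^ p ∈ 𝔓) (x : 𝓞 K) (n : ℕ) :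
    Ideal.Quotient.mk 𝔓 (σ ^ n • x) = Ideal.Quotient.mk 𝔓 x ^ p ^ n := by
  induction n with
  | zero => simp
  | succ n ih =>
    rw [pow_succ', mul_smul, pow_succ, pow_mul, ← ih, ← map_pow, Ideal.Quotient.eq]
    exact hσ _

theorem exists_ringOfIntegers_aeval_eq_zero {K : Type*} [Field K] [NumberField K] {f : ℤ[X]}
    (hf : f.Monic) {x : K} (hx : aeval x (f.map (Int.castRingHom ℚ)) = 0) :
    ∃ α : 𝓞 K, algebraMap (𝓞 K) K α = x ∧ aeval α f = 0 := by
  rw [← algebraMap_int_eq, aeval_map_algebraMap] at hx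
  obtain ⟨α, rfl⟩ : ∃ α : 𝓞 K, algebraMap (𝓞 K) K α = x := ⟨⟨x, f, hf, hx⟩, rfl⟩
  exact ⟨α, rfl, RingOfIntegers.coe_injective (by rw [map_zero, ← hx, aeval_algebraMap_apply])⟩

theorem natDegree_dvd_orderOf_of_irreducible_map {K : Type*} [Field K] [NumberField K]
    [IsGalois ℚ K] {f : ℤ[X]} (hf : f.Monic) {α : 𝓞 K} (hα : aeval α f = 0) {p : ℕ}
    (hp : p.Prime) (hfp : Irreducible (f.map (Int.castRingHom (ZMod p)))) :
    ∃ σ : Gal(K/ℚ), f.natDegree ∣ orderOf σ := by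
  have := Fact.mk hp
  have hmax : (span {(p : ℤ)}).IsMaximal :=
    PrincipalIdealRing.isMaximal_of_irreducible (Nat.prime_iff_prime_int.1 hp).irreducible
  obtain ⟨𝔓, h𝔓, hover⟩ :=
    Ideal.exists_maximal_ideal_liesOver_of_isIntegral (S := 𝓞 K) (span {(p : ℤ)})
  have hpmem : (p : 𝓞 K) ∈ 𝔓 := by
    have : (p : ℤ) ∈ span {(p : ℤ)} := mem_span_singleton_self _
    rw [hover.over, mem_under] at this
    simpa using this
  have : Finite (𝓞 K ⧸ 𝔓) := finiteQuotientOfFreeOfNeBot 𝔓 (ne_bot_of_natCast_mem hp hpmem)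
  obtain ⟨σ, hσ⟩ := IsArithFrobAt.exists_of_isInvariant ℤ Gal(K/ℚ) 𝔓
  have hσ' (x : 𝓞 K) : σ • x - x ^ p ∈ 𝔓 := by
    have := hσ x
    rwa [← hover.over, Int.card_ideal_quot] at this
  let _ := Ideal.Quotient.field 𝔓
  have := charP_quotient_of_natCast_mem hp hpmem
  let _ := ZMod.algebra (𝓞 K ⧸ 𝔓) p
  have hroot : aeval (Ideal.Quotient.mk 𝔓 α) f = 0 := by
    rw [← Ideal.Quotient.algebraMap_eq, aeval_algebraMap_apply, hα, map_zero]
  obtain ⟨hαint, h⟩ := irreducible_map_zmod_iff_natDegree_minpoly (p := p) hf hroot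
  refine ⟨σ, ?_⟩
  rw [← h.1 hfp, natDegree_minpoly_dvd_iff hαint, ← mk_pow_smul_eq_of_forall_smul_sub_pow_mem hσ',
    pow_orderOf_eq_one, one_smul]

theorem exists_irreducible_map_of_orderOf_eq_four {K : Type*} [Field K] [NumberField K]
    {f : ℤ[X]} (hf : f.Monic) (hdeg : f.natDegree = 4)
    [IsSplittingField ℚ K (f.map (Int.castRingHom ℚ))] [IsGalois ℚ K] {g : Gal(K/ℚ)}
    (hg : orderOf g = 4) :
    ∃ p : ℕ, p.Prime ∧ Irreducible (f.map (Int.castRingHom (ZMod p))) := by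
  have hg4 : g ^ 4 = 1 := hg ▸ pow_orderOf_eq_one g
  have hg2 : g ^ 2 ≠ 1 := pow_ne_one_of_lt_orderOf two_ne_zero (by simp [hg])
  have hgz : g ∉ Subgroup.zpowers (g ^ 2) := by
    intro h
    have h1 := orderOf_dvd_of_mem_zpowers h
    have h2 : orderOf (g ^ 2) ∣ 2 := orderOf_dvd_of_pow_eq_one (by rw [← pow_mul, hg4])
    have := h1.trans h2
    rw [hg] at this
    omega
  obtain ⟨α, hαf, hgα⟩ : ∃ α ∈ (f.map (Int.castRingHom ℚ)).rootSet K, (g ^ 2) α ≠ α := by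
    by_contra! h
    refine hg2 (AlgEquiv.ext fun x ↦ ?_)
    exact DFunLike.congr_fun (AlgHom.ext_of_adjoin_eq_top (φ₁ := (g ^ 2 : Gal(K/ℚ)).toAlgHom)
      (φ₂ := AlgHom.id ℚ K) (IsSplittingField.adjoin_rootSet K (f.map (Int.castRingHom ℚ))) h) x
  obtain ⟨α, rfl, hα⟩ := exists_ringOfIntegers_aeval_eq_zero hf (mem_rootSet.1 hαf).2
  have hδ : g ^ 2 • α - α ≠ 0 := sub_ne_zero.2 fun h ↦ hgα (congrArg (algebraMap (𝓞 K) K) h)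
  obtain ⟨p, hp, 𝔓, h𝔓, hpmem, hδ𝔓, σ, ⟨n, rfl⟩, hσ2, hσ⟩ := exists_isArithFrob_mem_zpowers hgz hδ
  have := Fact.mk hp
  have h𝔓max : 𝔓.IsMaximal := h𝔓.isMaximal (ne_bot_of_natCast_mem hp hpmem)
  refine ⟨p, hp, ?_⟩
  let _ := Ideal.Quotient.field 𝔓
  have := charP_quotient_of_natCast_mem hp hpmem
  let _ := ZMod.algebra (𝓞 K ⧸ 𝔓) p
  have hroot : aeval (Ideal.Quotient.mk 𝔓 α) f = 0 := by
    rw [← Ideal.Quotient.algebraMap_eq, aeval_algebraMap_apply, hα, map_zero]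
  obtain ⟨hαint, h⟩ := irreducible_map_zmod_iff_natDegree_minpoly (p := p) hf hroot
  have hpow := mk_pow_smul_eq_of_forall_smul_sub_pow_mem hσ α
  have hsq : (g ^ n) ^ 2 = g ^ 2 := by
    obtain ⟨k, rfl | rfl⟩ := Int.even_or_odd' n
    · refine absurd ⟨k, ?_⟩ hσ2
      simp [zpow_mul]
    · rw [← zpow_natCast, ← zpow_mul, show (2 * k + 1) * ((2 : ℕ) : ℤ) = (4 : ℕ) * k + (2 : ℕ) by
        push_cast; ring, zpow_add, zpow_mul, zpow_natCast, zpow_natCast, hg4, one_zpow, one_mul]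
  rw [h, hdeg]
  have h4 : (minpoly (ZMod p) (Ideal.Quotient.mk 𝔓 α)).natDegree ∣ 4 := by
    rw [natDegree_minpoly_dvd_iff hαint, ← hpow, show 4 = 2 * 2 from rfl, pow_mul, hsq,
      ← pow_mul, hg4, one_smul]
  have h2 : ¬ (minpoly (ZMod p) (Ideal.Quotient.mk 𝔓 α)).natDegree ∣ 2 := by
    rwa [natDegree_minpoly_dvd_iff hαint, ← hpow, hsq, Ideal.Quotient.eq]
  generalize (minpoly (ZMod p) (Ideal.Quotient.mk 𝔓 α)).natDegree = d at h4 h2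
  have := Nat.le_of_dvd (by norm_num) h4
  interval_cases d <;> omega

open Equiv

theorem exists_orderOf_eq_four_of_eight_dvd_card {H : Subgroup (Perm (Fin 4))}
    (h : 8 ∣ Nat.card H) : ∃ g ∈ H, orderOf g = 4 := by
  have := Fact.mk Nat.prime_two
  have hcard : Nat.card (Perm (Fin 4)) = 24 := by
    rw [Nat.card_eq_fintype_card, Fintype.card_perm, Fintype.card_fin]; rfl
  obtain ⟨P, hP⟩ := Sylow.exists_subgroup_card_pow_prime (G := H) 2 (n := 3) h
  let P' : Sylow 2 (Perm (Fin 4)) := Sylow.ofCard (P.map H.subtype) (by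
    rw [Subgroup.card_map_of_injective H.subtype_injective, hP, hcard,
      show 24 = 2 ^ 3 * 3 from rfl, Nat.factorization_mul (by norm_num) (by norm_num),
      Nat.factorization_pow, Nat.prime_two.factorization, Nat.prime_three.factorization]
    simp)
  have hc : orderOf (finRotate 4) = 4 :=
    orderOf_eq_prime_pow (p := 2) (n := 1) (by decide) (by decide)
  obtain ⟨Q, hQ⟩ := (IsPGroup.of_card (p := 2) (n := 2) (G := Subgroup.zpowers (finRotate 4))
    (by rw [Nat.card_zpowers, hc]; rfl)).exists_le_sylow
  obtain ⟨σ, hσ⟩ := MulAction.exists_smul_eq (Perm (Fin 4)) Q P'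
  refine ⟨σ * finRotate 4 * σ⁻¹, ?_, ?_⟩
  · have : σ * finRotate 4 * σ⁻¹ ∈ P' := by
      rw [← hσ]
      exact Subgroup.smul_mem_pointwise_smul _ (MulAut.conj σ) _ (hQ (Subgroup.mem_zpowers _))
    obtain ⟨x, -, hx⟩ := this
    rw [← hx]
    exact x.2
  · rw [← MulAut.conj_apply, MulEquiv.orderOf_eq, hc]

theorem mulEquiv_klein_or_alternating_of_orderOf_ne_four {G : Type*} [Group G]
    (φ : G →* Perm (Fin 4)) (hφ : Function.Injective φ) (hG : 4 ∣ Nat.card G)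
    (h4 : ∀ g : G, orderOf g ≠ 4) :
    Nonempty (G ≃* Multiplicative (ZMod 2 × ZMod 2)) ∨
      Nonempty (G ≃* alternatingGroup (Fin 4)) := by
  have hcard : Nat.card (Perm (Fin 4)) = 24 := by
    rw [Nat.card_eq_fintype_card, Fintype.card_perm, Fintype.card_fin]; rfl
  let e : G ≃* φ.range := MonoidHom.ofInjective hφ
  have he : Nat.card G = Nat.card φ.range := Nat.card_congr e.toEquiv
  have hdvd : Nat.card G ∣ 24 := by
    rw [he, ← hcard]
    exact Subgroup.card_subgroup_dvd_card _
  have h8 : ¬ 8 ∣ Nat.card G := fun h8 ↦ by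
    obtain ⟨g, ⟨x, rfl⟩, hg⟩ := exists_orderOf_eq_four_of_eight_dvd_card (he ▸ h8)
    exact h4 x (by rwa [orderOf_injective φ hφ] at hg)
  have h12 : Nat.card G = 4 ∨ Nat.card G = 12 := by
    generalize Nat.card G = n at *
    have := Nat.le_of_dvd (by norm_num) hdvd
    interval_cases n <;> omega
  obtain h | h := h12
  · left
    have : IsKleinFour G := by
      have hsq (g : G) : orderOf g ∣ 2 := by
        have h1 : orderOf g ∣ 4 := h ▸ orderOf_dvd_natCard g
        have h2 := h4 g
        generalize orderOf g = n at *
        have := Nat.le_of_dvd (by norm_num) h1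
        interval_cases n <;> omega
      refine ⟨h, (Nat.prime_two.eq_one_or_self_of_dvd _
        (Monoid.exponent_dvd.2 hsq)).resolve_left fun h1 ↦ ?_⟩
      have := Monoid.exp_eq_one_iff.1 h1
      simp at h
    exact IsKleinFour.nonempty_mulEquiv
  · right
    have : φ.range.index = 2 := by
      have := φ.range.card_mul_index
      rw [← he, h, hcard] at this
      omega
    exact ⟨e.trans (MulEquiv.subgroupCongr (Equiv.Perm.eq_alternatingGroup_of_index_eq_two this))⟩

theorem four_not_dvd_orderOf {G : Type*} [Group G]
    (h : Nonempty (G ≃* Multiplicative (ZMod 2 × ZMod 2)) ∨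
      Nonempty (G ≃* alternatingGroup (Fin 4))) (g : G) : ¬ 4 ∣ orderOf g := by
  obtain ⟨⟨e⟩⟩ | ⟨⟨e⟩⟩ := h
  · rw [← e.orderOf_eq]
    have : ∀ x : Multiplicative (ZMod 2 × ZMod 2), x ^ 2 = 1 := by decide
    intro h
    have := h.trans (orderOf_dvd_of_pow_eq_one (this (e g)))
    omega
  · rw [← e.orderOf_eq]
    have : ∀ x : alternatingGroup (Fin 4), x ^ 2 = 1 ∨ x ^ 3 = 1 := by decide
    intro h
    rcases this (e g) with h1 | h1 <;>
    · have := h.trans (orderOf_dvd_of_pow_eq_one h1)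
      omega

theorem exists_injective_galois_to_perm {F K : Type*} [Field F] [Field K] [Algebra F K] {q : F[X]}
    (hq : q.Separable) [IsSplittingField F K q] :
    ∃ φ : Gal(K/F) →* Perm (Fin q.natDegree), Function.Injective φ := by
  have := Fact.mk (IsSplittingField.splits q.SplittingField q)
  let e : Gal(K/F) ≃* q.Gal := AlgEquiv.autCongr (IsSplittingField.algEquiv K q)
  let r : q.rootSet q.SplittingField ≃ Fin q.natDegree :=
    Fintype.equivFinOfCardEq (card_rootSet_eq_natDegree hq this.out)
  exact ⟨r.permCongrHom.toMonoidHom.comp ((Gal.galActionHom q q.SplittingField).comp e.toMonoidHom),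
    r.permCongrHom.injective.comp ((Gal.galActionHom_injective q _).comp e.injective)⟩

theorem forall_not_irreducible_map_iff_of_natDegree_eq_four {K : Type*} [Field K] [NumberField K]
    {f : ℤ[X]} (hf : f.Monic) (hdeg : f.natDegree = 4)
    (hirr : Irreducible (f.map (Int.castRingHom ℚ)))
    [IsSplittingField ℚ K (f.map (Int.castRingHom ℚ))] :
    (∀ p : ℕ, p.Prime → ¬ Irreducible (f.map (Int.castRingHom (ZMod p)))) ↔
      (Nonempty (Gal(K/ℚ) ≃* Multiplicative (ZMod 2 × ZMod 2)) ∨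
        Nonempty (Gal(K/ℚ) ≃* alternatingGroup (Fin 4))) := by
  have hdeg' : (f.map (Int.castRingHom ℚ)).natDegree = 4 := by rw [hf.natDegree_map, hdeg]
  have : IsGalois ℚ K := IsGalois.of_separable_splitting_field hirr.separable
  obtain ⟨x, hx⟩ := (IsSplittingField.splits K (f.map (Int.castRingHom ℚ))).exists_eval_eq_zero
    (by rw [degree_map]; exact (degree_pos_of_irreducible hirr).ne')
  have hxf : aeval x (f.map (Int.castRingHom ℚ)) = 0 := by rwa [← eval_map_algebraMap]
  constructor
  · intro h
    obtain ⟨φ, hφ⟩ := hdeg' ▸ exists_injective_galois_to_perm (K := K) hirr.separable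
    refine mulEquiv_klein_or_alternating_of_orderOf_ne_four φ hφ ?_ fun g hg ↦ ?_
    · rw [IsGalois.card_aut_eq_finrank, ← hdeg',
        minpoly.eq_of_irreducible_of_monic hirr hxf (hf.map _)]
      exact minpoly.degree_dvd (Algebra.IsIntegral.isIntegral x)
    · obtain ⟨p, hp, hirr⟩ := exists_irreducible_map_of_orderOf_eq_four hf hdeg hg
      exact h p hp hirr
  · intro h p hp hirr
    obtain ⟨α, -, hα⟩ := exists_ringOfIntegers_aeval_eq_zero hf hxf
    obtain ⟨σ, hσ⟩ := natDegree_dvd_orderOf_of_irreducible_map (K := K) hf hα hp hirr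
    exact four_not_dvd_orderOf h σ (hdeg ▸ hσ)

/-- A monic irreducible quartic `f ∈ ℤ[x]` is reducible mod every prime `p`
iff its Galois group over `ℚ` is Klein's four group or `A₄`. -/
theorem stmt_3 (f : Polynomial ℤ) (hf : f.Monic) (hdeg : f.natDegree = 4)
    (hirr : Irreducible (f.map (Int.castRingHom ℚ)))
    (K : Type*) [Field K] [Algebra ℚ K]
    [Polynomial.IsSplittingField ℚ K (f.map (Int.castRingHom ℚ))] :
    (∀ p : ℕ, p.Prime → ¬ Irreducible (f.map (Int.castRingHom (ZMod p)))) ↔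
      (Nonempty ((K ≃ₐ[ℚ] K) ≃* Multiplicative (ZMod 2 × ZMod 2)) ∨
        Nonempty ((K ≃ₐ[ℚ] K) ≃* alternatingGroup (Fin 4))) := by
  have : CharZero K := algebraRat.charZero K
  obtain rfl : ‹Algebra ℚ K› = DivisionRing.toRatAlgebra := Subsingleton.elim _ _
  have : NumberField K :=
    { to_finiteDimensional :=
        IsSplittingField.finiteDimensional K (f.map (Int.castRingHom ℚ)) }
  exact forall_not_irreducible_map_iff_of_natDegree_eq_four hf hdeg hirr
end

section
/- For all integers a and b and every prime p, the polynomial x⁴ + 2a·x² + b² is reducible in 𝔽_p[x] (Hilbert's example). -/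
open Polynomial

/-- In a finite field, the product of two nonsquares is a square. -/
theorem FiniteField.isSquare_mul_of_not_isSquare {F : Type*} [Field F] [Finite F] {u v : F}
    (hu : ¬ IsSquare u) (hv : ¬ IsSquare v) : IsSquare (u * v) := by
  classical
  have := Fintype.ofFinite F
  have hu0 : u ≠ 0 := fun h => hu (h ▸ IsSquare.zero)
  have hv0 : v ≠ 0 := fun h => hv (h ▸ IsSquare.zero)
  rw [← quadraticChar_one_iff_isSquare (mul_ne_zero hu0 hv0), map_mul,
    quadraticChar_neg_one_iff_not_isSquare.mpr hu, quadraticChar_neg_one_iff_not_isSquare.mpr hv]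
  norm_num

/-- A product of two quadratic polynomials with leading coefficient one is not irreducible. -/
theorem Polynomial.not_irreducible_quadratic_mul_quadratic {F : Type*} [Field F] (r s t u : F) :
    ¬ Irreducible ((X ^ 2 + C r * X + C s) * (X ^ 2 + C t * X + C u)) := by
  have h (c d : F) : ¬ IsUnit (X ^ 2 + C c * X + C d) := by
    refine not_isUnit_of_natDegree_pos _ ?_
    have : (X ^ 2 + C c * X + C d).natDegree = 2 := by compute_degree!
    omega
  exact fun hirr => (hirr.isUnit_or_isUnit rfl).elim (h r s) (h t u)

/-- Over a finite field, the polynomial `x⁴ + 2a x² + b²` is never irreducible. -/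
theorem FiniteField.not_irreducible_X_pow_four_add {F : Type*} [Field F] [Finite F] (a b : F) :
    ¬ Irreducible (X ^ 4 + C (2 * a) * X ^ 2 + C (b ^ 2)) := by
  by_cases h₁ : IsSquare (2 * b - 2 * a)
  · obtain ⟨c, hc⟩ := h₁
    convert not_irreducible_quadratic_mul_quadratic c b (-c) b using 2
    rw [show 2 * a = 2 * b - c * c by linear_combination -hc]
    simp only [map_sub, map_mul, map_neg, map_pow, map_ofNat]
    ring
  by_cases h₂ : IsSquare (-2 * b - 2 * a)
  · obtain ⟨c, hc⟩ := h₂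
    convert not_irreducible_quadratic_mul_quadratic c (-b) (-c) (-b) using 2
    rw [show 2 * a = -2 * b - c * c by linear_combination -hc]
    simp only [map_sub, map_mul, map_neg, map_pow, map_ofNat]
    ring
  have two_ne_zero : (2 : F) ≠ 0 := fun h => h₁ (by simp [h])
  obtain ⟨c, hc⟩ := isSquare_mul_of_not_isSquare h₁ h₂
  obtain ⟨d, rfl⟩ : ∃ d, c = 2 * d := ⟨c / 2, by field_simp⟩
  have hd : b ^ 2 = a ^ 2 - d ^ 2 :=
    mul_left_cancel₀ (mul_ne_zero two_ne_zero two_ne_zero) (by linear_combination -hc)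
  convert not_irreducible_quadratic_mul_quadratic 0 (a + d) 0 (a - d) using 2
  rw [hd]
  simp only [map_add, map_sub, map_mul, map_pow, map_zero, map_ofNat]
  ring

/-- Hilbert's example: for all integers `a, b` and every prime `p`, the polynomial
`x⁴ + 2a x² + b²` is reducible in `𝔽_p[x]`. -/
theorem stmt_4 (a b : ℤ) (p : ℕ) (hp : p.Prime) :
    ¬ Irreducible (X ^ 4 + C (2 * (a : ZMod p)) * X ^ 2 + C ((b : ZMod p) ^ 2)) := by
  have := Fact.mk hp
  exact FiniteField.not_irreducible_X_pow_four_add _ _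
end
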